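/- arXiv:2412.11505 — 2 statements merged into one kernel-verified Lean document; each statement's English description precedes it below -/
import Mathlib

section
/- Let (x*, λ*) be a saddle point of Ψ. Then the following convergence rates of order o(1/k) hold as k → +∞: k·‖x_k − x_{k−1}‖ → 0, k·‖λ_k − λ_{k−1}‖ → 0, k·‖u_k + ∇_xΦ(x_k, λ_k)‖ → 0, k·‖v_k − ∇_λΦ(x_k, λ_k)‖ → 0, k·(⟨x_k − x*, u_k + ∇_xΦ(x_k, λ_k)⟩ + ⟨λ_k − λ*, v_k − ∇_λΦ(x_k, λ_k)⟩) → 0, and k·(Ψ(x_k, λ*) − Ψ(x*, λ_k)) → 0. -/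
open scoped RealInnerProductSpace Pointwise
open Filter

section Energy

variable {H : Type*} [NormedAddCommGroup H] [InnerProductSpace ℝ H]

/-- The part of the discrete energy that does not involve the distance to the anchor. -/
noncomputable def kineticEnergy (k : ℝ) (d q r s : H) : ℝ :=
  k ^ 2 * (1 / 2 * (‖d‖ ^ 2 + ⟪d, q⟫ + 1 / 2 * ‖q‖ ^ 2 + ⟪d, r⟫) + 1 / 8 * ‖s‖ ^ 2)

/-- The part of the discrete energy that involves the displacement `e` from the anchor. -/
noncomputable def anchorEnergy (α k : ℝ) (e d q : H) : ℝ :=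
  1 / 2 * (α - 1) * ‖e‖ ^ 2 + k * ⟪e, d + q⟫

theorem kineticEnergy_eq (k : ℝ) (d q r s : H) :
    kineticEnergy k d q r s = k ^ 2 * (1 / 2 * ‖(d + r) + (1 / 2 : ℝ) • (q - r)‖ ^ 2
      + 1 / 8 * ‖q - r‖ ^ 2 - 1 / 4 * ‖r‖ ^ 2 + 1 / 8 * ‖s‖ ^ 2) := by
  unfold kineticEnergy
  simp only [← real_inner_self_eq_norm_sq, inner_add_left, inner_add_right, inner_sub_left,
    inner_sub_right, real_inner_smul_left, real_inner_smul_right]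
  rw [real_inner_comm d q, real_inner_comm d r, real_inner_comm q r]
  ring

theorem energy_eq (α l k : ℝ) (e d q r s : H) :
    kineticEnergy k d q r s + l * anchorEnergy α k e d q =
      1 / 2 * ‖l • e + k • ((d + r) + (1 / 2 : ℝ) • (q - r))‖ ^ 2
      + 1 / 2 * l * (α - 1 - l) * ‖e‖ ^ 2 + 1 / 2 * l * k * ⟪e, q - r⟫
      + k ^ 2 * (1 / 8 * ‖q - r‖ ^ 2 - 1 / 4 * ‖r‖ ^ 2 + 1 / 8 * ‖s‖ ^ 2) := by
  unfold kineticEnergy anchorEnergy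
  simp only [← real_inner_self_eq_norm_sq, inner_add_left, inner_add_right, inner_sub_left,
    inner_sub_right, real_inner_smul_left, real_inner_smul_right]
  rw [real_inner_comm d q, real_inner_comm d r, real_inner_comm q r, real_inner_comm e q,
    real_inner_comm e r, real_inner_comm e d]
  ring

theorem energy_sub_eq (α c l k : ℝ) (hk : k ≠ 0) (e d q r s e' d' q' r' s' : H)
    (hd : k • d = (k + α) • d' + (k + α) • s' + c • q) (hs : s' = q' - q) (he : d' = e' - e) :
    (kineticEnergy (k + 1) d' q' r' s' + l * anchorEnergy α (k + 1) e' d' q')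
      - (kineticEnergy k d q r s + l * anchorEnergy α k e d q) =
    - (k * ((α - 1 - l) * ‖d'‖ ^ 2 - (l + 1 - c - α / 2) * ⟪d', q'⟫ + (c - 1) / 2 * ‖q'‖ ^ 2))
      - 1 / 2 * k ^ 2 * ⟪d', (q' - r') - (q - r)⟫
      - l * (c - 1) * ⟪e', q' - r'⟫
      - (α - 1 - l) * (1 + l / 2 + (α - 1 - l) / 2) * ‖d'‖ ^ 2
      - (1 / 2 * (c - 1 / 2) + 1 / 2 * (c - 1 / 2) ^ 2 - 1 / 8) * ‖q'‖ ^ 2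
      - (1 / 2 * (α - c) * k + 1 / 2 * (α - c) ^ 2) * ‖s'‖ ^ 2
      + -(l * (c - 1)) * ⟪e', r'⟫ + -(l * (α - c)) * ⟪e', s'⟫
      + -((c - 1 / 2 + (α - 1 - l) / 2) + (α - 1 - l) * (c - 1 / 2)) * ⟪d', q'⟫
      + (-(α - c + 1 / 2 + l / 2 + (α - 1 - l) / 2) * k + -((α - c) + (α - 1 - l) * (α - c)))
          * ⟪d', s'⟫
      + (-(1 / 4 + (α - c) / 2 + (c - 1 / 2) / 2) * k
          + -((α - c) / 2 + (c - 1 / 2) * (α - c))) * ⟪q', s'⟫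
      + (1 * k + 1 / 2) * ⟪d', r'⟫ + (-(α / 2) * k + 0) * ⟪d', r⟫ + (-(c / 2) * k + 0) * ⟪q', r⟫
      + ((c - α) / 2 * k + 0) * ⟪s', r⟫ + 1 / 8 * (2 * k + 1) * ‖s'‖ ^ 2
      - k ^ 2 * (1 / 8 * ‖s'‖ ^ 2 + 1 / 2 * ⟪s', r⟫ + 1 / 8 * ‖s‖ ^ 2) := by
  have hq : q = q' - s' := by rw [hs]; abel
  have he' : e = e' - d' := by rw [he]; abel
  have hd' : d = k⁻¹ • ((k + α) • d' + (k + α) • s' + c • (q' - s')) := by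
    rw [← hq, ← hd, inv_smul_smul₀ hk]
  clear hd hs he
  subst hq he'
  subst hd'
  unfold kineticEnergy anchorEnergy
  simp only [← real_inner_self_eq_norm_sq, inner_add_left, inner_add_right, inner_sub_left,
    inner_sub_right, real_inner_smul_left, real_inner_smul_right]
  rw [real_inner_comm d' q', real_inner_comm d' s', real_inner_comm q' s', real_inner_comm e' d']
  field_simp
  ring

theorem const_mul_inner_le (p : ℝ) (x y : H) : p * ⟪x, y⟫ ≤ |p| * (‖x‖ * ‖y‖) := by
  refine (le_abs_self _).trans ?_
  rw [abs_mul]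
  exact mul_le_mul_of_nonneg_left (abs_real_inner_le_norm x y) (abs_nonneg _)

theorem exists_quadratic_form_ge {a b χ : ℝ} (ha : 0 < a) (hb : 0 < b) (hχ : χ ^ 2 < 2 * a * b) :
    ∃ δ > 0, ∀ x y : H,
      δ * (‖x‖ ^ 2 + ‖y‖ ^ 2) ≤ a * ‖x‖ ^ 2 - χ * ⟪x, y⟫ + b / 2 * ‖y‖ ^ 2 := by
  have hs : 0 < 4 * a + 2 * b := by positivity
  set δ := (2 * a * b - χ ^ 2) / (4 * a + 2 * b) with hδ
  have hδs : δ * (4 * a + 2 * b) = 2 * a * b - χ ^ 2 := div_mul_cancel₀ _ hs.ne'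
  have hδ0 : 0 < δ := div_pos (by linarith) hs
  have haδ : 0 < a - δ := by
    by_contra! h
    have h' := mul_le_mul_of_nonneg_right (sub_nonpos.1 h) hs.le
    nlinarith [sq_nonneg χ, mul_pos ha ha]
  refine ⟨δ, hδ0, fun x y => ?_⟩
  have h1 := const_mul_inner_le χ x y
  have h2 : 0 ≤ 4 * (a - δ) * ((a - δ) * ‖x‖ ^ 2 - |χ| * (‖x‖ * ‖y‖) + (b / 2 - δ) * ‖y‖ ^ 2) := by
    have : 4 * (a - δ) * ((a - δ) * ‖x‖ ^ 2 - |χ| * (‖x‖ * ‖y‖) + (b / 2 - δ) * ‖y‖ ^ 2)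
        = (2 * (a - δ) * ‖x‖ - |χ| * ‖y‖) ^ 2 + 4 * δ ^ 2 * ‖y‖ ^ 2 := by
      linear_combination ‖y‖ ^ 2 * (-1) * hδs - ‖y‖ ^ 2 * sq_abs χ
    rw [this]
    positivity
  have h3 := nonneg_of_mul_nonneg_right h2 (by positivity)
  linarith

theorem affine_mul_inner_le (p q : ℝ) {k : ℝ} (hk : 1 ≤ k) (x y : H) :
    (p * k + q) * ⟪x, y⟫ ≤ (|p| + |q|) * (k * (‖x‖ * ‖y‖)) := by
  refine (const_mul_inner_le _ x y).trans ?_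
  rw [← mul_assoc (|p| + |q|)]
  refine mul_le_mul_of_nonneg_right ?_ (mul_nonneg (norm_nonneg x) (norm_nonneg y))
  calc |p * k + q| ≤ |p| * k + |q| := by
        simpa [abs_mul, abs_of_nonneg (zero_le_one.trans hk)] using abs_add_le (p * k) q
    _ ≤ (|p| + |q|) * k := by nlinarith [abs_nonneg q]

theorem exists_absorption {δ η M : ℝ} (hδ : 0 < δ) (hη : 0 < η) (hM : 0 ≤ M) :
    ∃ ε > 0, ∃ C ≥ 0, ∃ K ≥ 1, ∀ k ≥ K, ∀ A B F G e : ℝ,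
      -(k * (δ * (A ^ 2 + B ^ 2))) - k ^ 2 * (η * (F ^ 2 + G ^ 2))
        + M * (A ^ 2 + B ^ 2 + k * ((A + B) * (F + G)) + k * (F ^ 2 + G ^ 2) + e * F)
      ≤ -(ε * (k * (A ^ 2 + B ^ 2 + F ^ 2))) + C / k ^ 2 * e ^ 2 := by
  set N := M + 4 * M ^ 2 / η with hN
  have hN0 : 0 ≤ N := by positivity
  refine ⟨min (δ / 2) (η / 4), by positivity, M ^ 2 / η, by positivity,
    1 + 2 * N / δ + 4 * M / η, by
      have : 0 ≤ 2 * N / δ + 4 * M / η := by positivity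
      linarith, fun k hk A B F G e => ?_⟩
  have hp1 : 0 ≤ 2 * N / δ := by positivity
  have hp2 : 0 ≤ 4 * M / η := by positivity
  have hk1 : 1 ≤ k := by linarith
  have hk0 : 0 < k := by linarith
  have hkN : N ≤ k * δ / 2 := by
    have : 2 * N / δ ≤ k := by linarith
    rw [div_le_iff₀ hδ] at this
    linarith
  have hkM : M ≤ k * η / 4 := by
    have : 4 * M / η ≤ k := by linarith
    rw [div_le_iff₀ hη] at this
    linarith
  have h1 : M * (k * ((A + B) * (F + G)))
      ≤ 4 * M ^ 2 / η * (A ^ 2 + B ^ 2) + k ^ 2 * (η / 4 * (F ^ 2 + G ^ 2)) := by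
    have e1 : 4 * M ^ 2 / η * (A ^ 2 + B ^ 2) + k ^ 2 * (η / 4 * (F ^ 2 + G ^ 2))
        - M * (k * ((A + B) * (F + G)))
        = (2 * M ^ 2 / η * (A - B) ^ 2 + k ^ 2 * η / 8 * (F - G) ^ 2)
          + (4 * M * (A + B) - k * η * (F + G)) ^ 2 / (8 * η) := by
      field_simp
      ring
    have : 0 ≤ (2 * M ^ 2 / η * (A - B) ^ 2 + k ^ 2 * η / 8 * (F - G) ^ 2)
          + (4 * M * (A + B) - k * η * (F + G)) ^ 2 / (8 * η) := by positivity
    linarith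
  have h2 : M * (e * F) ≤ M ^ 2 / η / k ^ 2 * e ^ 2 + k ^ 2 * (η / 4 * F ^ 2) := by
    have e1 : M ^ 2 / η / k ^ 2 * e ^ 2 + k ^ 2 * (η / 4 * F ^ 2) - M * (e * F)
        = (2 * M * e - k ^ 2 * η * F) ^ 2 / (4 * η * k ^ 2) := by
      field_simp
      ring
    have : 0 ≤ (2 * M * e - k ^ 2 * η * F) ^ 2 / (4 * η * k ^ 2) := by positivity
    linarith
  have h3 : N * (A ^ 2 + B ^ 2) ≤ k * δ / 2 * (A ^ 2 + B ^ 2) :=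
    mul_le_mul_of_nonneg_right hkN (by positivity)
  have h4 : M * (k * (F ^ 2 + G ^ 2)) ≤ k ^ 2 * (η / 4 * (F ^ 2 + G ^ 2)) := by
    have := mul_le_mul_of_nonneg_right hkM (show 0 ≤ k * (F ^ 2 + G ^ 2) by positivity)
    nlinarith
  have h5 : min (δ / 2) (η / 4) * (k * (A ^ 2 + B ^ 2 + F ^ 2))
      ≤ k * δ / 2 * (A ^ 2 + B ^ 2) + k ^ 2 * (η / 4 * F ^ 2) := by
    have i1 : min (δ / 2) (η / 4) * (k * (A ^ 2 + B ^ 2)) ≤ δ / 2 * (k * (A ^ 2 + B ^ 2)) :=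
      mul_le_mul_of_nonneg_right (min_le_left _ _) (by positivity)
    have i2 : min (δ / 2) (η / 4) * (k * F ^ 2) ≤ η / 4 * (k * F ^ 2) :=
      mul_le_mul_of_nonneg_right (min_le_right _ _) (by positivity)
    have i3 : η / 4 * (k * F ^ 2) ≤ k ^ 2 * (η / 4 * F ^ 2) := by
      have := mul_le_mul_of_nonneg_right (show k ≤ k ^ 2 by nlinarith)
        (show 0 ≤ η / 4 * F ^ 2 by positivity)
      linarith
    linarith
  have h6 : 0 ≤ k ^ 2 * (η / 4 * G ^ 2) := by positivity
  rw [hN] at h3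
  linarith

theorem energy_increment_le {θ k δ C1 C2 C3 C4 C5 C6 C7 C8 C9 : ℝ} (hk : 1 ≤ k)
    (p1 : 0 ≤ C1) (p2 : 0 ≤ C2) (p3 : 0 ≤ C3) (p4 : 0 ≤ C4) (p5 : 0 ≤ C5) (p6 : 0 ≤ C6)
    (p7 : 0 ≤ C7) (p8 : 0 ≤ C8) (p9 : 0 ≤ C9)
    {A B F G E R R' : ℝ} (A0 : 0 ≤ A) (B0 : 0 ≤ B) (F0 : 0 ≤ F) (G0 : 0 ≤ G) (E0 : 0 ≤ E)
    (hR : R ≤ G) (hR' : R' ≤ F) {quad isr n1 n2 n3 n4 n5 T1 T2 T3 T4 T5 T6 T7 T8 T9 : ℝ}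
    (hquad : δ * (A ^ 2 + B ^ 2) ≤ quad) (hsr : -(θ / 4 * (F ^ 2 + G ^ 2)) ≤ 1 / 2 * isr)
    (hn1 : 0 ≤ n1) (hn2 : 0 ≤ n2) (hn3 : 0 ≤ n3) (hn4 : 0 ≤ n4) (hn5 : 0 ≤ n5)
    (t1 : T1 ≤ C1 * (E * R')) (t2 : T2 ≤ C2 * (E * F)) (t3 : T3 ≤ C3 * (A * B))
    (t4 : T4 ≤ C4 * (k * (A * F))) (t5 : T5 ≤ C5 * (k * (B * F))) (t6 : T6 ≤ C6 * (k * (A * R')))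
    (t7 : T7 ≤ C7 * (k * (A * R))) (t8 : T8 ≤ C8 * (k * (B * R))) (t9 : T9 ≤ C9 * (k * (F * R))) :
    -(k * quad) - n1 - n2 - n3 - n4 - n5 + T1 + T2 + T3 + T4 + T5 + T6 + T7 + T8 + T9
      + 1 / 8 * (2 * k + 1) * F ^ 2 - k ^ 2 * (1 / 8 * F ^ 2 + 1 / 2 * isr + 1 / 8 * G ^ 2)
    ≤ -(k * (δ * (A ^ 2 + B ^ 2))) - k ^ 2 * ((1 / 8 - θ / 4) * (F ^ 2 + G ^ 2))
        + (C1 + C2 + C3 + C4 + C5 + C6 + C7 + C8 + C9 + 3 / 8)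
          * (A ^ 2 + B ^ 2 + k * ((A + B) * (F + G)) + k * (F ^ 2 + G ^ 2) + E * F) := by
  have hk0 : 0 < k := by linarith
  have t0 := mul_le_mul_of_nonneg_left hquad hk0.le
  have n7 := mul_le_mul_of_nonneg_left hsr (sq_nonneg k)
  have n8 : 1 / 8 * (2 * k + 1) * F ^ 2 ≤ 3 / 8 * (k * F ^ 2) := by
    linarith only [mul_nonneg (sub_nonneg.2 hk) (sq_nonneg F)]
  obtain ⟨m, hm⟩ : ∃ m, m = A ^ 2 + B ^ 2 + k * ((A + B) * (F + G)) + k * (F ^ 2 + G ^ 2)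
    + E * F := ⟨_, rfl⟩
  rw [← hm]
  have hm' : m = A ^ 2 + B ^ 2 + k * (A * F) + k * (A * G) + k * (B * F) + k * (B * G) + k * F ^ 2
    + k * G ^ 2 + E * F := by rw [hm]; ring
  have hAA : 0 ≤ A ^ 2 := by positivity
  have hBB : 0 ≤ B ^ 2 := by positivity
  have hAB : 2 * (A * B) ≤ A ^ 2 + B ^ 2 := by linarith only [sq_nonneg (A - B)]
  have hAB' : 0 ≤ A * B := by positivity
  have hAF : 0 ≤ k * (A * F) := by positivity
  have hAG : 0 ≤ k * (A * G) := by positivity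
  have hBF : 0 ≤ k * (B * F) := by positivity
  have hBG : 0 ≤ k * (B * G) := by positivity
  have hFF : 0 ≤ k * F ^ 2 := by positivity
  have hGG : 0 ≤ k * G ^ 2 := by positivity
  have hEF : 0 ≤ E * F := by positivity
  have hFG : 2 * (k * (F * G)) ≤ k * F ^ 2 + k * G ^ 2 := by
    linarith only [mul_nonneg hk0.le (sq_nonneg (F - G))]
  have hFG' : 0 ≤ k * (F * G) := by positivity
  have w1 := mul_le_mul_of_nonneg_left hR' E0
  have w6 := mul_le_mul_of_nonneg_left (mul_le_mul_of_nonneg_left hR' A0) hk0.le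
  have w7 := mul_le_mul_of_nonneg_left (mul_le_mul_of_nonneg_left hR A0) hk0.le
  have w8 := mul_le_mul_of_nonneg_left (mul_le_mul_of_nonneg_left hR B0) hk0.le
  have w9 := mul_le_mul_of_nonneg_left (mul_le_mul_of_nonneg_left hR F0) hk0.le
  have mEF : E * F ≤ m := by linarith only [hm', hAA, hBB, hAF, hAG, hBF, hBG, hFF, hGG, hEF]
  have mAB : A * B ≤ m := by linarith only [hm', hAA, hBB, hAF, hAG, hBF, hBG, hFF, hGG, hEF, hAB,
    hAB']
  have mAF : k * (A * F) ≤ m := by linarith only [hm', hAA, hBB, hAF, hAG, hBF, hBG, hFF, hGG, hEF]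
  have mAG : k * (A * G) ≤ m := by linarith only [hm', hAA, hBB, hAF, hAG, hBF, hBG, hFF, hGG, hEF]
  have mBF : k * (B * F) ≤ m := by linarith only [hm', hAA, hBB, hAF, hAG, hBF, hBG, hFF, hGG, hEF]
  have mBG : k * (B * G) ≤ m := by linarith only [hm', hAA, hBB, hAF, hAG, hBF, hBG, hFF, hGG, hEF]
  have mFG : k * (F * G) ≤ m := by linarith only [hm', hAA, hBB, hAF, hAG, hBF, hBG, hFF, hGG, hEF, hFG,
    hFG']
  have mFF : k * F ^ 2 ≤ m := by linarith only [hm', hAA, hBB, hAF, hAG, hBF, hBG, hFF, hGG, hEF]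
  have v1 := t1.trans (mul_le_mul_of_nonneg_left (w1.trans mEF) p1)
  have v2 := t2.trans (mul_le_mul_of_nonneg_left mEF p2)
  have v3 := t3.trans (mul_le_mul_of_nonneg_left mAB p3)
  have v4 := t4.trans (mul_le_mul_of_nonneg_left mAF p4)
  have v5 := t5.trans (mul_le_mul_of_nonneg_left mBF p5)
  have v6 := t6.trans (mul_le_mul_of_nonneg_left (w6.trans mAF) p6)
  have v7 := t7.trans (mul_le_mul_of_nonneg_left (w7.trans mAG) p7)
  have v8 := t8.trans (mul_le_mul_of_nonneg_left (w8.trans mBG) p8)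
  have v9 := t9.trans (mul_le_mul_of_nonneg_left (w9.trans mFG) p9)
  linarith only [t0, n7, n8, v1, v2, v3, v4, v5, v6, v7, v8, v9, mFF, hn1, hn2, hn3, hn4, hn5]

theorem inner_ge_of_norm_le_mul {θ : ℝ} {r s s' : H} (hr : ‖r‖ ≤ θ * ‖s‖) (hθ : 0 ≤ θ) :
    -(θ / 4 * (‖s'‖ ^ 2 + ‖s‖ ^ 2)) ≤ 1 / 2 * ⟪s', r⟫ := by
  have h1 := (abs_le.1 (abs_real_inner_le_norm s' r)).1
  have h2 := mul_le_mul_of_nonneg_left hr (norm_nonneg s')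
  nlinarith [mul_nonneg hθ (sq_nonneg (‖s'‖ - ‖s‖))]

theorem exists_energy_decrease {α c l θ : ℝ} (hl : 0 < l) (ha : 0 < α - 1 - l) (hc : 1 < c)
    (hcα : c < α) (hχ : (l + 1 - c - α / 2) ^ 2 < 2 * (α - 1 - l) * (c - 1))
    (hθ0 : 0 ≤ θ) (hθ : θ < 1 / 2) :
    ∃ ε > 0, ∃ C ≥ 0, ∃ K ≥ 1, ∀ k ≥ K, ∀ e d q r s e' d' q' r' s' : H,
      k • d = (k + α) • d' + (k + α) • s' + c • q → s' = q' - q → d' = e' - e →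
      0 ≤ ⟪d', (q' - r') - (q - r)⟫ → 0 ≤ ⟪e', q' - r'⟫ → ‖r‖ ≤ θ * ‖s‖ → ‖r'‖ ≤ θ * ‖s'‖ →
      (kineticEnergy (k + 1) d' q' r' s' + l * anchorEnergy α (k + 1) e' d' q')
        - (kineticEnergy k d q r s + l * anchorEnergy α k e d q)
      ≤ -(ε * (k * (‖d'‖ ^ 2 + ‖q'‖ ^ 2 + ‖s'‖ ^ 2))) + C / k ^ 2 * ‖e'‖ ^ 2 := by
  obtain ⟨δ, hδ, hform⟩ := exists_quadratic_form_ge (H := H) ha (sub_pos.2 hc) hχ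
  obtain ⟨ε, hε, C, hC, K, hK, habs⟩ := exists_absorption (M := |-(l * (c - 1))| + |-(l * (α - c))|
    + |-((c - 1 / 2 + (α - 1 - l) / 2) + (α - 1 - l) * (c - 1 / 2))|
    + (|-(α - c + 1 / 2 + l / 2 + (α - 1 - l) / 2)| + |-((α - c) + (α - 1 - l) * (α - c))|)
    + (|-(1 / 4 + (α - c) / 2 + (c - 1 / 2) / 2)| + |-((α - c) / 2 + (c - 1 / 2) * (α - c))|)
    + (|(1 : ℝ)| + |(1 / 2 : ℝ)|) + (|-(α / 2)| + |(0 : ℝ)|) + (|-(c / 2)| + |(0 : ℝ)|)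
    + (|(c - α) / 2| + |(0 : ℝ)|) + 3 / 8) hδ (show 0 < 1 / 8 - θ / 4 by linarith) (by positivity)
  refine ⟨ε, hε, C, hC, K, hK, fun k hk e d q r s e' d' q' r' s' hd hs he hmono hanc hr hr' => ?_⟩
  have hk1 : 1 ≤ k := hK.trans hk
  refine le_trans ?_ (habs k hk ‖d'‖ ‖q'‖ ‖s'‖ ‖s‖ ‖e'‖)
  rw [energy_sub_eq α c l k (by linarith) e d q r s e' d' q' r' s' hd hs he]
  have hrs : ‖r‖ ≤ ‖s‖ := hr.trans (mul_le_of_le_one_left (norm_nonneg s) (by linarith))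
  have hrs' : ‖r'‖ ≤ ‖s'‖ := hr'.trans (mul_le_of_le_one_left (norm_nonneg s') (by linarith))
  have hca := sub_pos.2 hcα
  exact energy_increment_le hk1 (by positivity) (by positivity) (by positivity)
    (by positivity) (by positivity) (by positivity) (by positivity) (by positivity) (by positivity)
    (norm_nonneg _) (norm_nonneg _) (norm_nonneg _) (norm_nonneg _) (norm_nonneg _) hrs hrs'
    (hform d' q') (inner_ge_of_norm_le_mul hr hθ0) (by positivity)
    (mul_nonneg (mul_nonneg hl.le (by linarith)) hanc) (by positivity)
    (mul_nonneg (by nlinarith) (by positivity)) (by positivity) (const_mul_inner_le _ e' r')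
    (const_mul_inner_le _ e' s') (const_mul_inner_le _ d' q') (affine_mul_inner_le _ _ hk1 d' s')
    (affine_mul_inner_le _ _ hk1 q' s') (affine_mul_inner_le _ _ hk1 d' r')
    (affine_mul_inner_le _ _ hk1 d' r) (affine_mul_inner_le _ _ hk1 q' r)
    (affine_mul_inner_le _ _ hk1 s' r)

end Energy

section RealSequences

theorem exists_tendsto_and_summable_of_sub_le {a b ε : ℕ → ℝ} (ha : ∀ n, 0 ≤ a n)
    (hb : ∀ n, 0 ≤ b n) (hε : ∀ n, 0 ≤ ε n) (hε' : ∀ n, ε n ≤ 1 / 2) (hs : Summable ε)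
    (h : ∀ n, a (n + 1) - a n ≤ -b n + ε n * a (n + 1)) :
    (∃ l, Tendsto a atTop (nhds l)) ∧ Summable b := by
  have hsum : ∀ n, ∑ i ∈ Finset.range n, ε i ≤ ∑' i, ε i := fun n =>
    hs.sum_le_tsum _ fun i _ => hε i
  have hexp : ∀ n, a n ≤ a 0 * Real.exp (2 * ∑ i ∈ Finset.range n, ε i) := by
    intro n
    induction n with
    | zero => simp
    | succ n ih =>
      have h1 : a (n + 1) ≤ (1 + 2 * ε n) * a n := by
        have h2 : a (n + 1) * (1 - ε n) ≤ a n := by linarith [h n, hb n]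
        have h3 := mul_le_mul_of_nonneg_left h2 (show 0 ≤ 1 + 2 * ε n by linarith [hε n])
        have h4 : 0 ≤ ε n * (1 - 2 * ε n) * a (n + 1) :=
          mul_nonneg (mul_nonneg (hε n) (by linarith [hε' n])) (ha _)
        linarith
      have h5 : 1 + 2 * ε n ≤ Real.exp (2 * ε n) := by
        linarith [Real.add_one_le_exp (2 * ε n)]
      rw [Finset.sum_range_succ, mul_add, Real.exp_add]
      calc a (n + 1) ≤ (1 + 2 * ε n) * a n := h1
        _ ≤ Real.exp (2 * ε n) * (a 0 * Real.exp (2 * ∑ i ∈ Finset.range n, ε i)) :=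
            mul_le_mul h5 ih (ha n) (Real.exp_nonneg _)
        _ = _ := by ring
  set M := a 0 * Real.exp (2 * ∑' i, ε i) with hM
  have haM : ∀ n, a n ≤ M := fun n => (hexp n).trans <|
    mul_le_mul_of_nonneg_left (Real.exp_le_exp.2 (by linarith [hsum n])) (ha 0)
  have hM0 : 0 ≤ M := (ha 0).trans (haM 0)
  have hstep : ∀ n, a (n + 1) + b n ≤ a n + M * ε n := fun n => by
    have := mul_le_mul_of_nonneg_left (haM (n + 1)) (hε n)
    linarith [h n]
  constructor
  · have hanti : Antitone fun n => a n - M * ∑ i ∈ Finset.range n, ε i :=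
      antitone_nat_of_succ_le fun n => by
        rw [Finset.sum_range_succ]
        linarith [hstep n, hb n]
    have hbdd : BddBelow (Set.range fun n => a n - M * ∑ i ∈ Finset.range n, ε i) := by
      refine ⟨-(M * ∑' i, ε i), ?_⟩
      rintro _ ⟨n, rfl⟩
      have := mul_le_mul_of_nonneg_left (hsum n) hM0
      simp only
      linarith [ha n]
    have h1 := (tendsto_atTop_ciInf hanti hbdd).add (hs.hasSum.tendsto_sum_nat.const_mul M)
    exact ⟨_, h1.congr fun n => by ring⟩
  · refine summable_of_sum_range_le (c := a 0 + M * ∑' i, ε i) hb fun n => ?_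
    have : a n + ∑ i ∈ Finset.range n, b i ≤ a 0 + M * ∑ i ∈ Finset.range n, ε i := by
      induction n with
      | zero => simp
      | succ n ih =>
        rw [Finset.sum_range_succ, Finset.sum_range_succ]
        linarith [hstep n]
    linarith [ha n, mul_le_mul_of_nonneg_left (hsum n) hM0]

theorem exists_tendsto_and_summable_of_eventually_sub_le {a b : ℕ → ℝ} {C : ℝ} (hC : 0 ≤ C)
    (ha : ∀ᶠ n in atTop, 0 ≤ a n) (hb : ∀ n, 0 ≤ b n)
    (h : ∀ᶠ n : ℕ in atTop, a (n + 1) - a n ≤ -b n + C / (n : ℝ) ^ 2 * a (n + 1)) :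
    (∃ l, Tendsto a atTop (nhds l)) ∧ Summable b := by
  have hs : Summable fun n : ℕ => C / (n : ℝ) ^ 2 := by
    simpa [div_eq_mul_inv] using (Real.summable_nat_pow_inv.2 one_lt_two).mul_left C
  have hsmall : ∀ᶠ n : ℕ in atTop, C / (n : ℝ) ^ 2 ≤ 1 / 2 :=
    hs.tendsto_atTop_zero.eventually (ge_mem_nhds (by norm_num))
  obtain ⟨N, hN⟩ := eventually_atTop.1 ((ha.and h).and hsmall)
  obtain ⟨⟨l, hl⟩, hb'⟩ := exists_tendsto_and_summable_of_sub_le (a := fun n => a (n + N))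
    (b := fun n => b (n + N)) (ε := fun n => C / ((n + N : ℕ) : ℝ) ^ 2)
    (fun n => (hN _ (Nat.le_add_left N n)).1.1) (fun n => hb _) (fun n => by positivity)
    (fun n => (hN _ (Nat.le_add_left N n)).2) ((summable_nat_add_iff N).2 hs)
    (fun n => by
      have := (hN _ (Nat.le_add_left N n)).1.2
      rwa [show n + N + 1 = n + 1 + N by ring] at this)
  exact ⟨⟨l, (tendsto_add_atTop_iff_nat N).1 hl⟩, (summable_nat_add_iff N).1 hb'⟩

theorem tendsto_zero_of_le_succ_mul_summable {a b : ℕ → ℝ} {l : ℝ} (ha : ∀ᶠ n in atTop, 0 ≤ a n)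
    (hl : Tendsto a atTop (nhds l)) (hb : Summable b)
    (h : ∀ᶠ n : ℕ in atTop, a (n + 1) ≤ ((n : ℝ) + 1) * b n) : Tendsto a atTop (nhds 0) := by
  have hl0 : 0 ≤ l := ge_of_tendsto hl ha
  rcases hl0.eq_or_lt with h0 | h0
  · rwa [h0]
  exfalso
  have hev : ∀ᶠ n : ℕ in atTop, ‖(1 / ((n : ℝ) + 1))‖ ≤ 2 / l * b n := by
    filter_upwards [h, ((tendsto_add_atTop_iff_nat 1).2 hl).eventually
      (lt_mem_nhds (half_lt_self h0))] with n h1 h2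
    have hn : (0 : ℝ) < n + 1 := by positivity
    rw [Real.norm_of_nonneg (by positivity), div_le_iff₀ hn]
    have : l / 2 ≤ (n + 1) * b n := h2.le.trans h1
    calc (1 : ℝ) = 2 / l * (l / 2) := by field_simp
      _ ≤ 2 / l * ((n + 1) * b n) := mul_le_mul_of_nonneg_left this (by positivity)
      _ = _ := by ring
  have hsum : Summable fun n : ℕ => 1 / ((n : ℝ) + 1) :=
    Summable.of_norm_bounded_eventually_nat (hb.mul_left (2 / l)) hev
  refine Real.not_summable_one_div_natCast ((summable_nat_add_iff 1).1 ?_)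
  simpa using hsum

end RealSequences

section Scheme

variable {H : Type*} [NormedAddCommGroup H] [InnerProductSpace ℝ H]

theorem kineticEnergy_ge {k : ℝ} {d q r s : H} (hr : ‖r‖ ≤ 1 / 2 * ‖s‖) :
    1 / 2 * (k * ‖(d + r) + (1 / 2 : ℝ) • (q - r)‖) ^ 2 + 1 / 8 * (k * ‖q - r‖) ^ 2
      + 1 / 16 * (k * ‖s‖) ^ 2 ≤ kineticEnergy k d q r s := by
  have h : ‖r‖ ^ 2 ≤ (1 / 2 * ‖s‖) ^ 2 := pow_le_pow_left₀ (norm_nonneg _) hr 2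
  rw [kineticEnergy_eq]
  have := mul_le_mul_of_nonneg_left h (sq_nonneg k)
  linarith

theorem kineticEnergy_le {k : ℝ} {d q r s : H} (hr : ‖r‖ ≤ 1 / 2 * ‖s‖) :
    kineticEnergy k d q r s ≤ k ^ 2 * (‖d‖ ^ 2 + ‖q‖ ^ 2 + ‖s‖ ^ 2) := by
  have h : ‖r‖ ^ 2 ≤ (1 / 2 * ‖s‖) ^ 2 := pow_le_pow_left₀ (norm_nonneg _) hr 2
  refine mul_le_mul_of_nonneg_left ?_ (sq_nonneg k)
  have h1 := real_inner_le_norm d q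
  have h2 := real_inner_le_norm d r
  linarith [sq_nonneg (‖d‖ - ‖q‖), sq_nonneg (‖d‖ - ‖r‖), sq_nonneg ‖q‖, sq_nonneg ‖s‖]

theorem energy_ge {α l k : ℝ} {e d q r s : H} (hk : 0 ≤ k) (hl : 0 ≤ l) (hr : ‖r‖ ≤ 1 / 2 * ‖s‖)
    (hanc : 0 ≤ ⟪e, q - r⟫) :
    1 / 2 * l * (α - 1 - l) * ‖e‖ ^ 2
      ≤ kineticEnergy k d q r s + l * anchorEnergy α k e d q := by
  have h : ‖r‖ ^ 2 ≤ (1 / 2 * ‖s‖) ^ 2 := pow_le_pow_left₀ (norm_nonneg _) hr 2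
  have h1 : 0 ≤ 1 / 8 * ‖q - r‖ ^ 2 - 1 / 4 * ‖r‖ ^ 2 + 1 / 8 * ‖s‖ ^ 2 := by
    linarith [sq_nonneg ‖q - r‖, sq_nonneg ‖s‖]
  rw [energy_eq]
  have h2 := mul_nonneg (sq_nonneg k) h1
  have h3 : 0 ≤ 1 / 2 * l * k * ⟪e, q - r⟫ := by positivity
  linarith [sq_nonneg ‖l • e + k • ((d + r) + (1 / 2 : ℝ) • (q - r))‖]

theorem tendsto_energy {α c l θ : ℝ} (hl : 0 < l) (ha : 0 < α - 1 - l) (hc : 1 < c)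
    (hcα : c < α) (hχ : (l + 1 - c - α / 2) ^ 2 < 2 * (α - 1 - l) * (c - 1))
    (hθ0 : 0 ≤ θ) (hθ : θ < 1 / 2) {e d q r s : ℕ → H}
    (hd : ∀ᶠ n : ℕ in atTop, (n : ℝ) • d n
      = ((n : ℝ) + α) • d (n + 1) + ((n : ℝ) + α) • s (n + 1) + c • q n)
    (hs : ∀ᶠ n in atTop, s (n + 1) = q (n + 1) - q n)
    (he : ∀ᶠ n in atTop, d (n + 1) = e (n + 1) - e n)
    (hmono : ∀ᶠ n in atTop, 0 ≤ ⟪d (n + 1), (q (n + 1) - r (n + 1)) - (q n - r n)⟫)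
    (hanc : ∀ᶠ n in atTop, 0 ≤ ⟪e n, q n - r n⟫) (hr : ∀ᶠ n in atTop, ‖r n‖ ≤ θ * ‖s n‖) :
    (∃ E, Tendsto (fun n : ℕ => kineticEnergy n (d n) (q n) (r n) (s n)
      + l * anchorEnergy α n (e n) (d n) (q n)) atTop (nhds E)) ∧
    Summable fun n : ℕ => (n : ℝ) * (‖d (n + 1)‖ ^ 2 + ‖q (n + 1)‖ ^ 2 + ‖s (n + 1)‖ ^ 2) := by
  obtain ⟨ε, hε, C, hC, K, hK, hdec⟩ := exists_energy_decrease (H := H) hl ha hc hcα hχ hθ0 hθ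
  have hr2 : ∀ᶠ n in atTop, ‖r n‖ ≤ 1 / 2 * ‖s n‖ := hr.mono fun n h =>
    h.trans (mul_le_mul_of_nonneg_right hθ.le (norm_nonneg _))
  have hge : ∀ᶠ n : ℕ in atTop, 1 / 2 * l * (α - 1 - l) * ‖e n‖ ^ 2
      ≤ kineticEnergy n (d n) (q n) (r n) (s n) + l * anchorEnergy α n (e n) (d n) (q n) := by
    filter_upwards [hr2, hanc] with n h1 h2
    exact energy_ge n.cast_nonneg hl.le h1 h2
  have hpos : 0 < 1 / 2 * l * (α - 1 - l) := by positivity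
  have key := exists_tendsto_and_summable_of_eventually_sub_le
    (a := fun n : ℕ => kineticEnergy n (d n) (q n) (r n) (s n)
      + l * anchorEnergy α n (e n) (d n) (q n))
    (b := fun n : ℕ => ε * ((n : ℝ) * (‖d (n + 1)‖ ^ 2 + ‖q (n + 1)‖ ^ 2 + ‖s (n + 1)‖ ^ 2)))
    (C := C / (1 / 2 * l * (α - 1 - l))) (by positivity)
    (hge.mono fun n h => le_trans (by positivity) h) (fun n => by positivity) (by
      filter_upwards [hd, hs, he, hmono, (tendsto_add_atTop_nat 1).eventually hanc, hr,
        (tendsto_add_atTop_nat 1).eventually hr, (tendsto_add_atTop_nat 1).eventually hge,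
        tendsto_natCast_atTop_atTop.eventually (eventually_ge_atTop K)]
        with n h1 h2 h3 h4 h5 h6 h7 h8 h9
      have h10 := hdec n h9 _ _ _ _ _ _ _ _ _ _ h1 h2 h3 h4 h5 h6 h7
      have h11 := mul_le_mul_of_nonneg_left h8
        (show 0 ≤ C / (1 / 2 * l * (α - 1 - l)) / (n : ℝ) ^ 2 by positivity)
      have h12 : C / (1 / 2 * l * (α - 1 - l)) / (n : ℝ) ^ 2
          * (1 / 2 * l * (α - 1 - l) * ‖e (n + 1)‖ ^ 2) = C / (n : ℝ) ^ 2 * ‖e (n + 1)‖ ^ 2 := by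
        field_simp
      push_cast at h11 ⊢
      linarith)
  refine ⟨key.1, ?_⟩
  have := key.2.mul_left ε⁻¹
  simpa [← mul_assoc, inv_mul_cancel₀ hε.ne'] using this

theorem tendsto_zero_of_sq_le {a b : ℕ → ℝ} {C : ℝ} (hb : Tendsto b atTop (nhds 0))
    (h : ∀ᶠ n in atTop, a n ^ 2 ≤ C * b n) : Tendsto a atTop (nhds 0) := by
  have h1 : Tendsto (fun n => √(C * b n)) atTop (nhds 0) := by
    simpa using (hb.const_mul C).sqrt
  exact squeeze_zero_norm' (h.mono fun n hn => Real.abs_le_sqrt hn) h1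

theorem tendsto_scheme {α c θ : ℝ} (hα : 2 < α) (hcl : α / 2 < c) (hcu : c < α - 1)
    (hθ0 : 0 ≤ θ) (hθ : θ < 1 / 2) {z q p : ℕ → H} {zs : H}
    (hrec : ∀ n : ℕ, 1 ≤ n → (n : ℝ) • (z n - z (n - 1)) = ((n : ℝ) + α) • (z (n + 1) - z n)
      + ((n : ℝ) + α) • (q (n + 1) - q n) + c • q n)
    (hmono : ∀ n, 1 ≤ n → 0 ≤ ⟪z (n + 1) - z n, p (n + 1) - p n⟫)
    (hanc : ∀ n, 1 ≤ n → 0 ≤ ⟪z n - zs, p n⟫)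
    (hclose : ∀ n, 1 ≤ n → ‖q (n + 1) - p (n + 1)‖ ≤ θ * ‖q (n + 1) - q n‖) :
    Tendsto (fun n : ℕ => (n : ℝ) * ‖z n - z (n - 1)‖) atTop (nhds 0) ∧
    Tendsto (fun n : ℕ => (n : ℝ) * ‖p n‖) atTop (nhds 0) ∧
    ∃ M, ∀ᶠ n in atTop, ‖z n - zs‖ ≤ M := by
  set d : ℕ → H := fun n => z n - z (n - 1) with hd
  set s : ℕ → H := fun n => q n - q (n - 1) with hs
  set r : ℕ → H := fun n => q n - p n with hr
  set e : ℕ → H := fun n => z n - zs with he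
  have hqr : ∀ n, q n - r n = p n := fun n => by simp [hr]
  have hd' : ∀ᶠ n : ℕ in atTop, (n : ℝ) • d n
      = ((n : ℝ) + α) • d (n + 1) + ((n : ℝ) + α) • s (n + 1) + c • q n :=
    (eventually_ge_atTop 1).mono fun n hn => by simpa [hd, hs] using hrec n hn
  have hs' : ∀ᶠ n in atTop, s (n + 1) = q (n + 1) - q n := by simp [hs]
  have he' : ∀ᶠ n in atTop, d (n + 1) = e (n + 1) - e n := by simp [hd, he]
  have hmono' : ∀ᶠ n in atTop, 0 ≤ ⟪d (n + 1), (q (n + 1) - r (n + 1)) - (q n - r n)⟫ :=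
    (eventually_ge_atTop 1).mono fun n hn => by simpa [hd, hqr] using hmono n hn
  have hanc' : ∀ᶠ n in atTop, 0 ≤ ⟪e n, q n - r n⟫ :=
    (eventually_ge_atTop 1).mono fun n hn => by simpa [hqr] using hanc n hn
  have hr' : ∀ᶠ n in atTop, ‖r n‖ ≤ θ * ‖s n‖ := by
    filter_upwards [eventually_ge_atTop 2] with n hn
    obtain ⟨m, rfl⟩ : ∃ m, n = m + 1 := ⟨n - 1, by omega⟩
    simpa [hr, hs] using hclose m (by omega)
  have hr2 : ∀ᶠ n in atTop, ‖r n‖ ≤ 1 / 2 * ‖s n‖ := hr'.mono fun n h =>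
    h.trans (mul_le_mul_of_nonneg_right hθ.le (norm_nonneg _))
  obtain ⟨⟨E₁, hE₁⟩, hsum⟩ := tendsto_energy (l := α / 2) (by linarith) (by linarith)
    (by linarith) (by linarith) (by nlinarith) hθ0 hθ hd' hs' he' hmono' hanc' hr'
  obtain ⟨⟨E₂, hE₂⟩, -⟩ := tendsto_energy (l := 3 * α / 2 - 1 - c) (by linarith) (by linarith)
    (by linarith) (by linarith) (by nlinarith) hθ0 hθ hd' hs' he' hmono' hanc' hr'
  have hgap : α - 1 - c ≠ 0 := by linarith
  have hK : Tendsto (fun n : ℕ => kineticEnergy n (d n) (q n) (r n) (s n)) atTop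
      (nhds (E₁ - α / 2 * ((E₂ - E₁) / (α - 1 - c)))) := by
    refine (hE₁.sub (((hE₂.sub hE₁).div_const (α - 1 - c)).const_mul (α / 2))).congr fun n => ?_
    field_simp
    ring
  have hK0 : Tendsto (fun n : ℕ => kineticEnergy n (d n) (q n) (r n) (s n)) atTop (nhds 0) := by
    refine tendsto_zero_of_le_succ_mul_summable ?_ hK (hsum.mul_left 2) ?_
    · filter_upwards [hr2] with n h
      exact le_trans (by positivity) (kineticEnergy_ge h)
    · filter_upwards [(tendsto_add_atTop_nat 1).eventually hr2, eventually_ge_atTop 1] with n h hn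
      refine (kineticEnergy_le h).trans ?_
      have hn' : (1 : ℝ) ≤ n := by exact_mod_cast hn
      have : ((n + 1 : ℕ) : ℝ) ^ 2 ≤ ((n : ℝ) + 1) * (2 * n) := by
        push_cast
        nlinarith
      refine (mul_le_mul_of_nonneg_right this (by positivity)).trans (le_of_eq (by ring))
  have hD : Tendsto (fun n : ℕ => (n : ℝ) * ‖(d n + r n) + (1 / 2 : ℝ) • (q n - r n)‖) atTop
      (nhds 0) := tendsto_zero_of_sq_le (C := 2) hK0 <| hr2.mono fun n h => by
    have := kineticEnergy_ge (k := n) (d := d n) (q := q n) h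
    nlinarith [sq_nonneg ((n : ℝ) * ‖q n - r n‖), sq_nonneg ((n : ℝ) * ‖s n‖)]
  have hP : Tendsto (fun n : ℕ => (n : ℝ) * ‖q n - r n‖) atTop
      (nhds 0) := tendsto_zero_of_sq_le (C := 8) hK0 <| hr2.mono fun n h => by
    have := kineticEnergy_ge (k := n) (d := d n) (q := q n) h
    nlinarith [sq_nonneg ((n : ℝ) * ‖(d n + r n) + (1 / 2 : ℝ) • (q n - r n)‖),
      sq_nonneg ((n : ℝ) * ‖s n‖)]
  have hS : Tendsto (fun n : ℕ => (n : ℝ) * ‖s n‖) atTop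
      (nhds 0) := tendsto_zero_of_sq_le (C := 16) hK0 <| hr2.mono fun n h => by
    have := kineticEnergy_ge (k := n) (d := d n) (q := q n) h
    nlinarith [sq_nonneg ((n : ℝ) * ‖(d n + r n) + (1 / 2 : ℝ) • (q n - r n)‖),
      sq_nonneg ((n : ℝ) * ‖q n - r n‖)]
  refine ⟨?_, hP.congr fun n => by rw [hqr], ?_⟩
  · have hlim : Tendsto (fun n : ℕ => (n : ℝ) * ‖(d n + r n) + (1 / 2 : ℝ) • (q n - r n)‖
        + 1 / 2 * ((n : ℝ) * ‖q n - r n‖) + 1 / 2 * ((n : ℝ) * ‖s n‖)) atTop (nhds 0) := by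
      simpa only [mul_zero, add_zero] using
        (hD.add (hP.const_mul (1 / 2))).add (hS.const_mul (1 / 2))
    refine squeeze_zero' (Eventually.of_forall fun n => by positivity) ?_ hlim
    filter_upwards [hr2] with n h
    have h1 : d n = ((d n + r n) + (1 / 2 : ℝ) • (q n - r n)) - (1 / 2 : ℝ) • (q n - r n) - r n := by
      abel
    have h2 : ‖d n‖ ≤ ‖(d n + r n) + (1 / 2 : ℝ) • (q n - r n)‖ + 1 / 2 * ‖q n - r n‖
        + 1 / 2 * ‖s n‖ := by
      calc ‖d n‖ = _ := congrArg norm h1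
        _ ≤ ‖(d n + r n) + (1 / 2 : ℝ) • (q n - r n)‖ + ‖(1 / 2 : ℝ) • (q n - r n)‖ + ‖r n‖ :=
          (norm_sub_le _ _).trans <| by gcongr; exact norm_sub_le _ _
        _ ≤ _ := by
          rw [norm_smul, Real.norm_of_nonneg (by norm_num : (0 : ℝ) ≤ 1 / 2)]
          linarith
    exact (mul_le_mul_of_nonneg_left h2 n.cast_nonneg).trans (le_of_eq (by ring))
  · have hpos : 0 < 1 / 2 * (α / 2) * (α - 1 - α / 2) :=
      mul_pos (by linarith) (by linarith)
    refine ⟨√((E₁ + 1) / (1 / 2 * (α / 2) * (α - 1 - α / 2))), ?_⟩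
    filter_upwards [hr2, hanc', hE₁.eventually (gt_mem_nhds (lt_add_one E₁))] with n h1 h2 h3
    refine Real.le_sqrt_of_sq_le ?_
    rw [le_div_iff₀ hpos, mul_comm]
    exact (energy_ge n.cast_nonneg (by linarith) h1 h2).trans h3.le

end Scheme

section Transfer

theorem ConvexOn.add_inner_gradient_le {E : Type*} [NormedAddCommGroup E] [InnerProductSpace ℝ E]
    [CompleteSpace E] {F : E → ℝ} (hF : ConvexOn ℝ Set.univ F) {a G : E}
    (h : HasGradientAt F G a) (b : E) : F a + ⟪G, b - a⟫ ≤ F b := by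
  have hc : ConvexOn ℝ Set.univ (F ∘ AffineMap.lineMap (k := ℝ) a b) :=
    hF.comp_affineMap (AffineMap.lineMap a b)
  have hl : HasDerivAt (AffineMap.lineMap (k := ℝ) a b) (b - a) 0 := AffineMap.hasDerivAt_lineMap
  have hd : HasDerivAt (F ∘ AffineMap.lineMap (k := ℝ) a b) ⟪G, b - a⟫ 0 := by
    have hG : HasFDerivAt F (InnerProductSpace.toDual ℝ E G)
        (AffineMap.lineMap (k := ℝ) a b 0) := by
      simpa using h.hasFDerivAt
    simpa using hG.comp_hasDerivAt (0 : ℝ) hl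
  have := hc.le_slope_of_hasDerivAt (Set.mem_univ _) (Set.mem_univ _) zero_lt_one hd
  simp only [slope_def_field, Function.comp_apply, AffineMap.lineMap_apply_one,
    AffineMap.lineMap_apply_zero, sub_zero, div_one] at this
  linarith

theorem ConcaveOn.le_add_inner_gradient {E : Type*} [NormedAddCommGroup E] [InnerProductSpace ℝ E]
    [CompleteSpace E] {F : E → ℝ} (hF : ConcaveOn ℝ Set.univ F) {a G : E}
    (h : HasGradientAt F G a) (b : E) : F b ≤ F a + ⟪G, b - a⟫ := by
  have := hF.neg.add_inner_gradient_le (G := -G) (a := a)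
    (by simpa [hasGradientAt_iff_hasFDerivAt] using h.hasFDerivAt.neg) b
  simp only [Pi.neg_apply, inner_neg_left] at this
  linarith

variable {X : Type*} [NormedAddCommGroup X] [InnerProductSpace ℝ X]
  {Y : Type*} [NormedAddCommGroup Y] [InnerProductSpace ℝ Y]

/-- The duality gap of a convex-concave function at a point `(x, l)` is bounded by the pairing with
a subgradient selection at that point. -/
theorem gap_le_inner [CompleteSpace X] [CompleteSpace Y] {f : X → ℝ} {g : Y → ℝ} {Φ : X → Y → ℝ}
    {Φx : X → Y → X} {Φy : X → Y → Y}
    (hΦx : ∀ (a : X) (b : Y), HasGradientAt (fun x' => Φ x' b) (Φx a b) a)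
    (hΦy : ∀ (a : X) (b : Y), HasGradientAt (fun y' => Φ a y') (Φy a b) b)
    (hΦcvx : ∀ b : Y, ConvexOn ℝ Set.univ fun x' => Φ x' b)
    (hΦccv : ∀ a : X, ConcaveOn ℝ Set.univ fun y' => Φ a y')
    {x u : X} {l v : Y} (hu : ∀ x' : X, f x + ⟪u, x' - x⟫ ≤ f x')
    (hv : ∀ l' : Y, g l + ⟪v, l' - l⟫ ≤ g l') (x' : X) (l' : Y) :
    (f x + Φ x l' - g l') - (f x' + Φ x' l - g l)
      ≤ ⟪x - x', u + Φx x l⟫ + ⟪l - l', v - Φy x l⟫ := by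
  have h₁ := hu x'
  have h₂ := hv l'
  have h₃ := (hΦcvx l).add_inner_gradient_le (hΦx x l) x'
  have h₄ := (hΦccv x).le_add_inner_gradient (hΦy x l) l'
  rw [← neg_sub x x', inner_neg_right, real_inner_comm] at h₁ h₃
  rw [← neg_sub l l', inner_neg_right, real_inner_comm] at h₂ h₄
  rw [inner_add_right, inner_sub_right]
  linarith

/-- Clearing denominators in the extrapolation step. -/
theorem smul_sub_eq_of_extrapolation {α c k : ℝ} (hk : k + α ≠ 0) {y y' z z' z'' : X}
    (h : y = z + (1 - α / (k + α)) • (z - z') + (1 - c / (k + α)) • (y' - z)) :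
    k • (z - z') = (k + α) • (z'' - z) + (k + α) • ((y - z'') - (y' - z)) + c • (y' - z) := by
  have h₁ : (k + α) • y = (k + α) • z + k • (z - z') + (k + α - c) • (y' - z) := by
    rw [h, smul_add, smul_add, smul_smul, smul_smul]
    congr 3
    · field_simp
      ring
    · field_simp
  have h₂ : (k + α) • (z'' - z) + (k + α) • ((y - z'') - (y' - z)) + c • (y' - z)
      = (k + α) • y - (k + α) • z - (k + α - c) • (y' - z) := by module
  rw [h₂, h₁]
  abel

/-- The proximal step with an extrapolated gradient: the residual is controlled by the gap between
the extrapolation point and the new iterate. -/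
theorem sub_smul_residual {γ : ℝ} (hγ : γ ≠ 0) {y z u G G' : X} (hu : u = γ⁻¹ • (y - z) - G) :
    (y - z) - γ • (u + G') = γ • (G - G') := by
  rw [hu, smul_add, smul_sub, smul_inv_smul₀ hγ]
  module

end Transfer

theorem stmt_12
    {X : Type*} [NormedAddCommGroup X] [InnerProductSpace ℝ X] [CompleteSpace X]
    {Y : Type*} [NormedAddCommGroup Y] [InnerProductSpace ℝ Y] [CompleteSpace Y]
    (f : X → ℝ) (g : Y → ℝ) (Φ : X → Y → ℝ) (Φx : X → Y → X) (Φy : X → Y → Y) (L α c γ : ℝ)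
    (hf : ConvexOn ℝ Set.univ f) (hflsc : LowerSemicontinuous f)
    (hg : ConvexOn ℝ Set.univ g) (hglsc : LowerSemicontinuous g)
    (hΦx : ∀ (a : X) (b : Y), HasGradientAt (fun x' => Φ x' b) (Φx a b) a)
    (hΦy : ∀ (a : X) (b : Y), HasGradientAt (fun y' => Φ a y') (Φy a b) b)
    (hΦcvx : ∀ b : Y, ConvexOn ℝ Set.univ fun x' => Φ x' b)
    (hΦccv : ∀ a : X, ConcaveOn ℝ Set.univ fun y' => Φ a y')
    (hL : 0 < L)
    (hΦlip : ∀ (a : X) (b : Y) (a' : X) (b' : Y),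
      ‖Φx a b - Φx a' b'‖ ^ 2 + ‖Φy a b - Φy a' b'‖ ^ 2 ≤ L ^ 2 * (‖a - a'‖ ^ 2 + ‖b - b'‖ ^ 2))
    (hα : 2 < α) (hcl : α / 2 < c) (hcu : c < α - 1)
    (hγ0 : 0 < γ) (hγ : γ < 1 / (2 * L))
    (x y1 w1 : ℕ → X) (lam y2 w2 : ℕ → Y) (u : ℕ → X) (v : ℕ → Y)
    (hy1 : ∀ k : ℕ, 1 ≤ k → y1 k = x k + (1 - α / ((k : ℝ) + α)) • (x k - x (k - 1))
        + (1 - c / ((k : ℝ) + α)) • (y1 (k - 1) - x k))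
    (hy2 : ∀ k : ℕ, 1 ≤ k → y2 k = lam k + (1 - α / ((k : ℝ) + α)) • (lam k - lam (k - 1))
        + (1 - c / ((k : ℝ) + α)) • (y2 (k - 1) - lam k))
    (hw1 : ∀ k : ℕ, 1 ≤ k → w1 k = y1 k - (y1 (k - 1) - x k))
    (hw2 : ∀ k : ℕ, 1 ≤ k → w2 k = y2 k - (y2 (k - 1) - lam k))
    (hu : ∀ k : ℕ, u (k + 1) = γ⁻¹ • (y1 k - x (k + 1)) - Φx (w1 k) (w2 k))
    (husub : ∀ k : ℕ, ∀ x' : X, f (x (k + 1)) + ⟪u (k + 1), x' - x (k + 1)⟫ ≤ f x')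
    (hvdef : ∀ k : ℕ, v (k + 1) = γ⁻¹ • (y2 k - lam (k + 1)) + Φy (w1 k) (w2 k))
    (hvsub : ∀ k : ℕ, ∀ b' : Y, g (lam (k + 1)) + ⟪v (k + 1), b' - lam (k + 1)⟫ ≤ g b')
    (xs : X) (ls : Y)
    (hsad : ∀ (x' : X) (l' : Y),
      f xs + Φ xs l' - g l' ≤ f xs + Φ xs ls - g ls ∧
      f xs + Φ xs ls - g ls ≤ f x' + Φ x' ls - g ls) :
    Tendsto (fun k : ℕ => (k : ℝ) * ‖x k - x (k - 1)‖) atTop (nhds 0) ∧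
    Tendsto (fun k : ℕ => (k : ℝ) * ‖lam k - lam (k - 1)‖) atTop (nhds 0) ∧
    Tendsto (fun k : ℕ => (k : ℝ) * ‖u k + Φx (x k) (lam k)‖) atTop (nhds 0) ∧
    Tendsto (fun k : ℕ => (k : ℝ) * ‖v k - Φy (x k) (lam k)‖) atTop (nhds 0) ∧
    Tendsto (fun k : ℕ => (k : ℝ) *
      (⟪x k - xs, u k + Φx (x k) (lam k)⟫ + ⟪lam k - ls, v k - Φy (x k) (lam k)⟫)) atTop (nhds 0) ∧
    Tendsto (fun k : ℕ => (k : ℝ) *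
      ((f (x k) + Φ (x k) ls - g ls) - (f xs + Φ xs (lam k) - g (lam k)))) atTop (nhds 0) := by
  have hgap : ∀ n : ℕ, 1 ≤ n → ∀ (x' : X) (l' : Y),
      (f (x n) + Φ (x n) l' - g l') - (f x' + Φ x' (lam n) - g (lam n))
        ≤ ⟪x n - x', u n + Φx (x n) (lam n)⟫ + ⟪lam n - l', v n - Φy (x n) (lam n)⟫ := by
    intro n hn x' l'
    obtain ⟨m, rfl⟩ := Nat.exists_eq_add_of_le' hn
    exact gap_le_inner hΦx hΦy hΦcvx hΦccv (husub m) (hvsub m) x' l'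
  have hgap0 : ∀ n : ℕ, 0 ≤ (f (x n) + Φ (x n) ls - g ls) - (f xs + Φ xs (lam n) - g (lam n)) := by
    intro n
    have := hsad (x n) (lam n)
    linarith
  obtain ⟨z, hz⟩ : ∃ z : ℕ → WithLp 2 (X × Y), ∀ n, z n = WithLp.toLp 2 (x n, lam n) :=
    ⟨_, fun _ => rfl⟩
  obtain ⟨q, hq⟩ : ∃ q : ℕ → WithLp 2 (X × Y),
      ∀ n, q n = WithLp.toLp 2 (y1 (n - 1) - x n, y2 (n - 1) - lam n) := ⟨_, fun _ => rfl⟩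
  obtain ⟨r, hr⟩ : ∃ r : ℕ → WithLp 2 (X × Y), ∀ n, r n = WithLp.toLp 2
      (u n + Φx (x n) (lam n), v n - Φy (x n) (lam n)) := ⟨_, fun _ => rfl⟩
  obtain ⟨zs, hzs⟩ : ∃ zs : WithLp 2 (X × Y), zs = WithLp.toLp 2 (xs, ls) := ⟨_, rfl⟩
  have hinner : ∀ n, ⟪z n - zs, r n⟫ = ⟪x n - xs, u n + Φx (x n) (lam n)⟫
      + ⟪lam n - ls, v n - Φy (x n) (lam n)⟫ := by
    intro n
    simp [hz, hr, hzs, WithLp.prod_inner_apply]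
  have hrec : ∀ n : ℕ, 1 ≤ n → (n : ℝ) • (z n - z (n - 1)) = ((n : ℝ) + α) • (z (n + 1) - z n)
      + ((n : ℝ) + α) • (q (n + 1) - q n) + c • q n := by
    intro n hn
    have hk : (n : ℝ) + α ≠ 0 := by positivity
    have h₁ := smul_sub_eq_of_extrapolation hk (z'' := x (n + 1)) (hy1 n hn)
    have h₂ := smul_sub_eq_of_extrapolation hk (z'' := lam (n + 1)) (hy2 n hn)
    simp only [hz, hq, Nat.add_sub_cancel, ← WithLp.toLp_sub, ← WithLp.toLp_smul,
      ← WithLp.toLp_add, Prod.mk_sub_mk, Prod.smul_mk, Prod.mk_add_mk, h₁, h₂]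
  have hmono : ∀ n : ℕ, 1 ≤ n → 0 ≤ ⟪z (n + 1) - z n, γ • r (n + 1) - γ • r n⟫ := by
    intro n hn
    rw [← smul_sub, real_inner_smul_right]
    refine mul_nonneg hγ0.le ?_
    have h₁ := hgap n hn (x (n + 1)) (lam (n + 1))
    have h₂ := hgap (n + 1) n.succ_pos (x n) (lam n)
    rw [← neg_sub (x (n + 1)) (x n), ← neg_sub (lam (n + 1)) (lam n), inner_neg_left,
      inner_neg_left] at h₁
    simp only [hz, hr, WithLp.prod_inner_apply, WithLp.ofLp_sub, Prod.fst_sub, Prod.snd_sub,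
      inner_sub_right (𝕜 := ℝ) (x (n + 1) - x n) (u (n + 1) + _),
      inner_sub_right (𝕜 := ℝ) (lam (n + 1) - lam n) (v (n + 1) - _)]
    linarith
  have hanc : ∀ n : ℕ, 1 ≤ n → 0 ≤ ⟪z n - zs, γ • r n⟫ := by
    intro n hn
    rw [real_inner_smul_right, hinner]
    exact mul_nonneg hγ0.le ((hgap0 n).trans (hgap n hn xs ls))
  have hclose : ∀ n : ℕ, 1 ≤ n →
      ‖q (n + 1) - γ • r (n + 1)‖ ≤ γ * L * ‖q (n + 1) - q n‖ := by
    intro n hn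
    have h₁ := sub_smul_residual hγ0.ne' (hu n) (G' := Φx (x (n + 1)) (lam (n + 1)))
    have h₂ : (y2 n - lam (n + 1)) - γ • (v (n + 1) - Φy (x (n + 1)) (lam (n + 1)))
        = γ • (Φy (x (n + 1)) (lam (n + 1)) - Φy (w1 n) (w2 n)) := by
      have hv : v (n + 1) = γ⁻¹ • (y2 n - lam (n + 1)) - -Φy (w1 n) (w2 n) := by
        rw [sub_neg_eq_add, hvdef]
      simpa [← sub_eq_add_neg, neg_add_eq_sub]
        using sub_smul_residual hγ0.ne' hv (G' := -Φy (x (n + 1)) (lam (n + 1)))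
    have hw₁ : w1 n - x (n + 1) = (y1 n - x (n + 1)) - (y1 (n - 1) - x n) := by
      rw [hw1 n hn]; abel
    have hw₂ : w2 n - lam (n + 1) = (y2 n - lam (n + 1)) - (y2 (n - 1) - lam n) := by
      rw [hw2 n hn]; abel
    have hlip := hΦlip (w1 n) (w2 n) (x (n + 1)) (lam (n + 1))
    rw [hw₁, hw₂] at hlip
    refine le_of_sq_le_sq ?_ (by positivity)
    rw [mul_pow, WithLp.prod_norm_sq_eq_of_L2, WithLp.prod_norm_sq_eq_of_L2]
    simp only [hq, hr, Nat.add_sub_cancel, WithLp.sub_fst, WithLp.sub_snd, WithLp.smul_fst,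
      WithLp.smul_snd, WithLp.toLp_fst, WithLp.toLp_snd, h₁, h₂, norm_smul, Real.norm_eq_abs, mul_pow, sq_abs]
    rw [norm_sub_rev (Φy (x (n + 1)) _)]
    nlinarith [mul_le_mul_of_nonneg_left hlip (sq_nonneg γ)]
  have hθ : γ * L < 1 / 2 := by
    rw [lt_div_iff₀ (by positivity)] at hγ
    linarith
  obtain ⟨hd, hp, M, hM⟩ := tendsto_scheme (p := fun n => γ • r n) hα hcl hcu (by positivity) hθ
    hrec hmono hanc hclose
  have hres : Tendsto (fun k : ℕ => (k : ℝ) * ‖r k‖) atTop (nhds 0) := by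
    have h := hp.const_mul γ⁻¹
    rw [mul_zero] at h
    refine h.congr fun k => ?_
    rw [norm_smul, Real.norm_of_nonneg hγ0.le]
    field_simp
  have hpair : Tendsto (fun k : ℕ => (k : ℝ) * ⟪z k - zs, r k⟫) atTop (nhds 0) := by
    have h := hres.const_mul M
    rw [mul_zero] at h
    refine squeeze_zero_norm' ?_ h
    filter_upwards [hM] with k hk
    rw [norm_mul, Real.norm_of_nonneg k.cast_nonneg, mul_left_comm]
    gcongr
    exact (norm_inner_le_norm _ _).trans (by gcongr)
  have hd' : ∀ k : ℕ, z k - z (k - 1) = WithLp.toLp 2 (x k - x (k - 1), lam k - lam (k - 1)) :=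
    fun k => by rw [hz, hz, ← WithLp.toLp_sub, Prod.mk_sub_mk]
  refine ⟨squeeze_zero (fun k => by positivity) (fun k => ?_) hd,
    squeeze_zero (fun k => by positivity) (fun k => ?_) hd,
    squeeze_zero (fun k => by positivity) (fun k => ?_) hres,
    squeeze_zero (fun k => by positivity) (fun k => ?_) hres,
    hpair.congr fun k => by rw [hinner], squeeze_zero' ?_ ?_ hpair⟩
  · rw [hd']
    gcongr
    exact WithLp.norm_fst_le X (WithLp.toLp 2 (_, _))
  · rw [hd']
    gcongr
    exact WithLp.norm_snd_le X (WithLp.toLp 2 (_, _))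
  · rw [hr]
    gcongr
    exact WithLp.norm_fst_le X (WithLp.toLp 2 (_, _))
  · rw [hr]
    gcongr
    exact WithLp.norm_snd_le X (WithLp.toLp 2 (_, _))
  · exact .of_forall fun k => mul_nonneg k.cast_nonneg (hgap0 k)
  · filter_upwards [eventually_ge_atTop 1] with k hk
    rw [hinner]
    exact mul_le_mul_of_nonneg_left (hgap k hk xs ls) k.cast_nonneg
end

section
/- Suppose there exists at least one primal-dual solution of the cone-constrained problem. Then the sequence (x_k, λ_k)_{k≥0} converges weakly to a primal-dual solution: there exists (x̄, λ̄) ∈ X × Y which is a primal-dual solution such that ⟨x_k, p⟩ → ⟨x̄, p⟩ for every p ∈ X and ⟨λ_k, q⟩ → ⟨λ̄, q⟩ for every q ∈ Y as k → +∞. -/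
open scoped RealInnerProductSpace Pointwise
open Filter

section RealSequences

lemma exists_pos_le_quadratic {A B C : ℝ} (hA : 0 < A) (hC : 0 < C)
    (hdisc : B ^ 2 < 4 * A * C) :
    ∃ ε : ℝ, 0 < ε ∧ ∀ x y : ℝ, ε * (x ^ 2 + y ^ 2) ≤ A * x ^ 2 - B * (x * y) + C * y ^ 2 := by
  obtain ⟨ε, hε⟩ : ∃ ε, ε = (4 * A * C - B ^ 2) / (4 * (A + C)) := ⟨_, rfl⟩
  have hε' : ε * (4 * (A + C)) = 4 * A * C - B ^ 2 := by rw [hε]; field_simp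
  have hεpos : 0 < ε := by rw [hε]; apply div_pos <;> linarith
  refine ⟨ε, hεpos, fun x y => ?_⟩
  have hεA : 0 < A - ε := by
    by_contra hcon
    have h1 : A * (4 * (A + C)) ≤ ε * (4 * (A + C)) := by
      apply mul_le_mul_of_nonneg_right <;> linarith
    nlinarith [sq_nonneg B, mul_pos hA hA]
  have h2 : 0 ≤ 4 * (A - ε) * (C - ε) - B ^ 2 := by nlinarith [sq_nonneg ε]
  have h3 : 0 ≤ 4 * (A - ε) * ((A - ε) * x ^ 2 - B * (x * y) + (C - ε) * y ^ 2) := by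
    nlinarith [sq_nonneg (2 * (A - ε) * x - B * y), mul_nonneg h2 (sq_nonneg y)]
  have h4 := nonneg_of_mul_nonneg_right h3 (by linarith)
  linarith

lemma tendsto_and_summable_of_almost_decreasing {E T : ℕ → ℝ} (hE : ∀ k, 0 ≤ E k)
    (hT : ∀ k, 0 ≤ T k) {C : ℝ} (hC : 0 ≤ C) {N : ℕ}
    (hstep : ∀ k ≥ N, E (k + 1) + T k ≤ E k + C / ((k : ℝ) + 1) ^ 2 * E (k + 1)) :
    (∃ l, Tendsto E atTop (nhds l)) ∧ Summable T := by
  let ω : ℕ → ℝ := fun k => 1 + 2 * C / ((k : ℝ) + 1)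
  have hω1 : ∀ k, 1 ≤ ω k := fun k => by
    have : 0 ≤ 2 * C / ((k : ℝ) + 1) := by positivity
    simp only [ω]; linarith
  have hωlim : Tendsto ω atTop (nhds 1) := by
    have := (tendsto_one_div_add_atTop_nhds_zero_nat (𝕜 := ℝ)).const_mul (2 * C)
    have := this.const_add 1
    simp only [mul_zero, add_zero, mul_one_div] at this
    exact this
  obtain ⟨M, hM⟩ := exists_nat_ge (8 * C + 2)
  have hdec : ∀ k ≥ N + M, ω (k + 1) * E (k + 1) + T k ≤ ω k * E k := by
    intro k hk
    have hm : 8 * C + 2 ≤ (k : ℝ) + 1 := by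
      have : (M : ℝ) ≤ k := by exact_mod_cast (by omega : M ≤ k)
      linarith
    have hs := hstep k (by omega)
    have hωk : ω (k + 1) ≤ ω k * (1 - C / ((k : ℝ) + 1) ^ 2) := by
      simp only [ω]
      push_cast
      generalize (k : ℝ) + 1 = m at hm
      have hm0 : 0 < m := by linarith
      rw [← sub_nonneg]
      have : (1 + 2 * C / m) * (1 - C / m ^ 2) - (1 + 2 * C / (m + 1)) =
          C * (m * (m - 1) - 2 * C * (m + 1)) / (m ^ 3 * (m + 1)) := by
        field_simp; ring
      rw [this]
      apply div_nonneg _ (by positivity)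
      apply mul_nonneg hC
      nlinarith [mul_nonneg hC (by linarith : 0 ≤ m - 2)]
    have h1 := hω1 k
    have h2 := mul_le_mul_of_nonneg_right hωk (hE (k + 1))
    have h3 : ω k * ((1 - C / ((k : ℝ) + 1) ^ 2) * E (k + 1) + T k) ≤ ω k * E k :=
      mul_le_mul_of_nonneg_left (by linarith) (by linarith)
    have h4 := mul_le_mul_of_nonneg_right h1 (hT k)
    nlinarith
  have hω0 : ∀ k, 0 ≤ ω k * E k := fun k => mul_nonneg (by linarith [hω1 k]) (hE k)
  constructor
  · have hanti : Antitone fun k => ω (k + (N + M)) * E (k + (N + M)) := by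
      apply antitone_nat_of_succ_le
      intro k
      have := hdec (k + (N + M)) (by omega)
      rw [show k + 1 + (N + M) = k + (N + M) + 1 by omega]
      linarith [hT (k + (N + M))]
    have hconv := tendsto_atTop_ciInf hanti ⟨0, by rintro _ ⟨k, rfl⟩; exact hω0 _⟩
    have hconv' := (tendsto_add_atTop_iff_nat (f := fun k => ω k * E k) (N + M)).1 hconv
    refine ⟨_, (hconv'.div hωlim one_ne_zero).congr fun k => ?_⟩
    have := hω1 k
    simp only [Pi.div_apply]
    field_simp
  · rw [← summable_nat_add_iff (N + M)]
    refine summable_of_sum_range_le (c := ω (N + M) * E (N + M)) (fun k => hT _) fun n => ?_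
    suffices h : ∑ i ∈ Finset.range n, T (i + (N + M)) + ω (n + (N + M)) * E (n + (N + M)) ≤
        ω (N + M) * E (N + M) by linarith [hω0 (n + (N + M))]
    induction n with
    | zero => simp
    | succ n ih =>
      rw [Finset.sum_range_succ]
      have := hdec (n + (N + M)) (by omega)
      rw [show n + 1 + (N + M) = n + (N + M) + 1 by omega]
      linarith

/-- A discrete version of: if `τ ψ + t ψ'` tends to `0` with `τ ≥ 1`, then so does `ψ`. -/
lemma tendsto_zero_of_add_mul_sub_tendsto_zero {ψ : ℕ → ℝ} {τ : ℝ} (hτ : 1 ≤ τ)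
    (h : Tendsto (fun k : ℕ => τ * ψ (k + 1) + ((k : ℝ) + 1) * (ψ (k + 1) - ψ k)) atTop (nhds 0)) :
    Tendsto ψ atTop (nhds 0) := by
  rw [Metric.tendsto_atTop] at h ⊢
  intro ε hε
  obtain ⟨N, hN⟩ := h (ε / 2) (by linarith)
  let B : ℝ := ((N : ℝ) + 1) * |ψ N|
  have hB : 0 ≤ B := by positivity
  have key : ∀ j : ℕ, (((N + j : ℕ) : ℝ) + 1) * (|ψ (N + j)| - ε / 2) ≤ B := by
    intro j
    induction j with
    | zero => simp only [B, add_zero]; nlinarith [(Nat.cast_nonneg N : (0 : ℝ) ≤ N)]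
    | succ j ih =>
      have h1 := hN (N + j) (by omega)
      rw [Real.dist_eq, sub_zero] at h1
      rw [show N + (j + 1) = N + j + 1 by omega]
      push_cast at ih h1 ⊢
      set m : ℝ := (N : ℝ) + j + 1 with hm
      have hm0 : 0 < m := by positivity
      have h2 : (τ + m) * |ψ (N + j + 1)| ≤ m * |ψ (N + j)| + ε / 2 := by
        have : (τ + m) * ψ (N + j + 1) = m * ψ (N + j) +
            (τ * ψ (N + j + 1) + m * (ψ (N + j + 1) - ψ (N + j))) := by ring
        calc (τ + m) * |ψ (N + j + 1)| = |(τ + m) * ψ (N + j + 1)| := by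
              rw [abs_mul, abs_of_pos (by linarith : 0 < τ + m)]
          _ ≤ |m * ψ (N + j)| + _ := by rw [this]; exact abs_add_le _ _
          _ ≤ _ := by rw [abs_mul, abs_of_pos hm0]; linarith
      by_cases hneg : |ψ (N + j + 1)| - ε / 2 ≤ 0
      · exact le_trans (mul_nonpos_of_nonneg_of_nonpos (by positivity) hneg) hB
      · push Not at hneg
        nlinarith
  obtain ⟨M, hM⟩ := exists_nat_gt (B / (ε / 2))
  refine ⟨N + M, fun n hn => ?_⟩
  obtain ⟨j, rfl⟩ : ∃ j, n = N + j := ⟨n - N, by omega⟩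
  rw [Real.dist_eq, sub_zero]
  have hk := key j
  have hnM : (M : ℝ) ≤ ((N + j : ℕ) : ℝ) := by exact_mod_cast (by omega : M ≤ N + j)
  rw [div_lt_iff₀ (by linarith)] at hM
  by_contra! hcon
  nlinarith

end RealSequences

section Energy

variable {E : Type*} [NormedAddCommGroup E] [InnerProductSpace ℝ E]

/-- The discrete Lyapunov energy of the accelerated scheme. -/
noncomputable def fastEnergy (lam a μ r n : ℝ) (s Δ V e dV : E) : ℝ :=
  1 / 2 * ‖lam • s + n • Δ + (n + r + 1) • V‖ ^ 2 + 1 / 2 * lam * a * ‖s‖ ^ 2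
    + μ * (1 / 2 * ‖n • Δ‖ ^ 2 + (n + r) * ⟪n • Δ, e⟫ + 1 / 4 * ((n + r) * ‖dV‖) ^ 2)

lemma le_fastEnergy {lam a μ r n θ : ℝ} (hμ : 0 ≤ μ) (hnr : 0 ≤ n + r)
    (hθ : θ < 1 / 2) {s Δ V e dV : E} (he : ‖e‖ ≤ θ * ‖dV‖) :
    1 / 2 * lam * a * ‖s‖ ^ 2 ≤ fastEnergy lam a μ r n s Δ V e dV := by
  have h1 : -(‖n • Δ‖ * ‖e‖) ≤ ⟪n • Δ, e⟫ := neg_le_of_abs_le (abs_real_inner_le_norm _ _)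
  have h2 : ‖n • Δ‖ * ‖e‖ ≤ ‖n • Δ‖ * (θ * ‖dV‖) :=
    mul_le_mul_of_nonneg_left he (norm_nonneg _)
  have h3 : -(θ * (‖n • Δ‖ * ((n + r) * ‖dV‖))) ≤ (n + r) * ⟪n • Δ, e⟫ := by
    nlinarith [mul_le_mul_of_nonneg_left (neg_le_neg h2 |>.trans h1) hnr]
  have h4 : 0 ≤ 1 / 2 * ‖n • Δ‖ ^ 2 + (n + r) * ⟪n • Δ, e⟫ + 1 / 4 * ((n + r) * ‖dV‖) ^ 2 := by
    have hx : 0 ≤ ‖n • Δ‖ := norm_nonneg _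
    have hy : 0 ≤ (n + r) * ‖dV‖ := by positivity
    generalize (n + r) * ‖dV‖ = y at *
    generalize ‖n • Δ‖ = x at *
    nlinarith [sq_nonneg (x - y), mul_nonneg (mul_nonneg hx hy) (by linarith : 0 ≤ 1 / 2 - θ),
      sq_nonneg (x - y / 2)]
  unfold fastEnergy
  nlinarith [sq_nonneg ‖lam • s + n • Δ + (n + r + 1) • V‖, mul_nonneg hμ h4]

lemma energy_anchor_step (lam a b n r : ℝ) (hla : 0 ≤ lam * a) (s Δ V : E) :
    1 / 2 * ‖lam • s + n • Δ + (n + r + 1) • V‖ ^ 2 + 1 / 2 * lam * a * ‖s‖ ^ 2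
      - (1 / 2 * ‖lam • s + n • Δ + (n + r + 1) • V + (a • Δ + b • V)‖ ^ 2
        + 1 / 2 * lam * a * ‖s - Δ‖ ^ 2)
    ≤ -(lam * b * ⟪s, V⟫) - n * a * ‖Δ‖ ^ 2 - (n * b + (n + r + 1) * a) * ⟪Δ, V⟫
      - (n + r + 1) * b * ‖V‖ ^ 2 := by
  rw [norm_add_sq_real (lam • s + n • Δ + (n + r + 1) • V), norm_sub_sq_real]
  have h1 : ⟪lam • s + n • Δ + (n + r + 1) • V, a • Δ + b • V⟫ =
      lam * a * ⟪s, Δ⟫ + lam * b * ⟪s, V⟫ + n * a * ‖Δ‖ ^ 2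
      + (n * b + (n + r + 1) * a) * ⟪Δ, V⟫ + (n + r + 1) * b * ‖V‖ ^ 2 := by
    simp only [inner_add_left, inner_add_right, real_inner_smul_left, real_inner_smul_right,
      real_inner_self_eq_norm_sq, real_inner_comm Δ V]
    ring
  rw [h1]
  nlinarith [sq_nonneg ‖a • Δ + b • V‖, mul_nonneg hla (sq_nonneg ‖Δ‖)]

lemma energy_velocity_step (κ : ℝ) (D G g dW e e' : E)
    (hg : g = G + κ • (dW + e - e')) :
    1 / 2 * ‖D‖ ^ 2 + κ * ⟪D, e⟫ - (1 / 2 * ‖D + g‖ ^ 2 + (κ - 1) * ⟪D + g, e'⟫) =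
      -⟪D, G⟫ - κ * ⟪D, dW⟫ - 1 / 2 * ‖g‖ ^ 2 - (κ - 1) * ⟪g, e'⟫ + ⟪D, e'⟫ := by
  have h : ⟪D, g⟫ = ⟪D, G⟫ + κ * (⟪D, dW⟫ + ⟪D, e⟫ - ⟪D, e'⟫) := by
    rw [hg]; simp only [inner_add_right, inner_sub_right, real_inner_smul_right]
  rw [norm_add_sq_real, h, inner_add_left]
  ring

/-- The scalar estimate absorbing the error terms of the velocity part of the energy. -/
lemma velocity_error_le {θ g y G x z : ℝ} (hθ0 : 0 ≤ θ) (hθ : θ < 1 / 2)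
    (hz : 0 ≤ z) (hzg : z ≤ g + G) :
    -(1 / 2 * g ^ 2) + θ * (g * y) - 1 / 4 * y ^ 2 + x * y + 1 / 4 * z ^ 2 ≤
      -((1 / 4 - θ / 2) / 4 * z ^ 2) + (1 / (1 / 4 - θ / 2) + 1) * (x ^ 2 + G ^ 2) := by
  obtain ⟨δ, hδ⟩ : ∃ δ, δ = 1 / 4 - θ / 2 := ⟨_, rfl⟩
  have hδ0 : 0 < δ := by linarith
  have hδ1 : δ ≤ 1 / 4 := by linarith
  rw [← hδ]
  have hz2 : z ^ 2 ≤ (g + G) ^ 2 := by nlinarith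
  have h1 : θ * (g * y) ≤ θ / 2 * (g ^ 2 + y ^ 2) := by nlinarith [sq_nonneg (g - y)]
  have h2 : x * y ≤ δ / 2 * y ^ 2 + 1 / (2 * δ) * x ^ 2 := by
    have : δ / 2 * y ^ 2 + 1 / (2 * δ) * x ^ 2 - x * y = (δ * y - x) ^ 2 / (2 * δ) := by
      field_simp; ring
    have : 0 ≤ (δ * y - x) ^ 2 / (2 * δ) := by positivity
    linarith
  have h3 : 1 / 2 * (g * G) ≤ δ / 4 * g ^ 2 + 1 / (4 * δ) * G ^ 2 := by
    have : δ / 4 * g ^ 2 + 1 / (4 * δ) * G ^ 2 - 1 / 2 * (g * G)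
        = (δ * g - G) ^ 2 / (4 * δ) := by
      field_simp; ring
    have : 0 ≤ (δ * g - G) ^ 2 / (4 * δ) := by positivity
    linarith
  have h4 : (g + G) ^ 2 ≤ 2 * g ^ 2 + 2 * G ^ 2 := by nlinarith [sq_nonneg (g - G)]
  have h5 : 1 / (2 * δ) * x ^ 2 = 1 / δ * x ^ 2 / 2 := by field_simp
  have h6 : 1 / (4 * δ) * G ^ 2 = 1 / δ * G ^ 2 / 4 := by field_simp
  have h7 : 0 ≤ 1 / δ * x ^ 2 := by positivity
  have h8 : 0 ≤ 1 / δ * G ^ 2 := by positivity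
  have h9 : δ * z ^ 2 ≤ δ * (2 * g ^ 2 + 2 * G ^ 2) :=
    mul_le_mul_of_nonneg_left (hz2.trans h4) hδ0.le
  have h10 : δ * G ^ 2 ≤ 1 / 4 * G ^ 2 := mul_le_mul_of_nonneg_right hδ1 (sq_nonneg G)
  have h11 : θ = 1 / 2 - 2 * δ := by linarith
  subst h11
  nlinarith [sq_nonneg x, sq_nonneg G, mul_nonneg hδ0.le (sq_nonneg y)]

set_option maxHeartbeats 1000000 in
lemma fastEnergy_step {α c θ lam μ : ℝ} (hc : 1 < c) (hcα : c < α - 1) (hθ0 : 0 ≤ θ)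
    (hθ : θ < 1 / 2) (hlam : 0 < lam) (hlamα : lam < α - 1) (hμ : 0 < μ)
    (hdisc : (α - 1 - lam + (c - 1) + μ * c) ^ 2
      < 4 * (α - 1 - lam + μ * (α - 1)) * (c - 1)) :
    ∃ ε : ℝ, 0 < ε ∧ ∃ C : ℝ, 0 ≤ C ∧ ∀ n : ℝ, 2 ≤ n → ∀ s Δ V W Δ' V' W' dV' : E,
      (n - 1) • Δ' + (n - 1 + α - c) • V' = (n - 1 + α) • (Δ + V) →
      ‖V - W‖ ≤ θ * ‖V - V'‖ → ‖V' - W'‖ ≤ θ * ‖dV'‖ →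
      0 ≤ ⟪Δ, W - W'⟫ →
      fastEnergy lam (α - 1 - lam) μ (α - c - 1) n s Δ V (V - W) (V - V')
        + lam * (c - 1) * ⟪s, W⟫ + (ε * n - C) * (‖Δ‖ ^ 2 + ‖V‖ ^ 2)
        + ε * n ^ 2 * ‖V - V'‖ ^ 2
      ≤ fastEnergy lam (α - 1 - lam) μ (α - c - 1) (n - 1) (s - Δ) Δ' V' (V' - W') dV'
        + C * (‖s‖ ^ 2 / n ^ 2) := by
  obtain ⟨a, ha⟩ : ∃ a, a = α - 1 - lam := ⟨_, rfl⟩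
  obtain ⟨b, hb⟩ : ∃ b, b = c - 1 := ⟨_, rfl⟩
  obtain ⟨r, hr⟩ : ∃ r, r = α - c - 1 := ⟨_, rfl⟩
  obtain ⟨δ, hδ⟩ : ∃ δ, δ = 1 / 4 - θ / 2 := ⟨_, rfl⟩
  rw [← ha, ← hb] at hdisc
  rw [← ha, ← hb, ← hr]
  have ha0 : 0 < a := by linarith
  have hb0 : 0 < b := by linarith
  have hr0 : 0 < r := by linarith
  have hδ0 : 0 < δ := by linarith
  have hA : 0 < a + μ * (α - 1) := by
    have := mul_pos hμ (by linarith : 0 < α - 1)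
    linarith
  obtain ⟨ε₀, hε₀, hquad⟩ := exists_pos_le_quadratic hA hb0 hdisc
  obtain ⟨C₁, hC₁⟩ : ∃ C₁, C₁ = μ * ((1 / δ + 1) * (1 + 2 * α ^ 2)) + (r + 1) * a / 2 := ⟨_, rfl⟩
  obtain ⟨C₂, hC₂⟩ : ∃ C₂, C₂ = 2 * (lam * b * θ) ^ 2 / (μ * δ) := ⟨_, rfl⟩
  have hC₁0 : 0 ≤ C₁ := by rw [hC₁]; positivity
  have hC₂0 : 0 ≤ C₂ := by rw [hC₂]; positivity
  refine ⟨min ε₀ (μ * δ / 8), by positivity, C₁ + C₂, by positivity, ?_⟩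
  intro n hn s Δ V W Δ' V' W' dV' hrec herr herr' hmono
  have hκ : n - 1 + α - c = n + r := by rw [hr]; ring
  rw [hκ] at hrec
  have hn0 : 0 < n := by linarith
  obtain ⟨G, hG⟩ : ∃ G, G = (α - 1) • Δ + c • V := ⟨_, rfl⟩
  obtain ⟨g, hg⟩ : ∃ g, g = G + (n + r) • (V - V') := ⟨_, rfl⟩
  have hD' : (n - 1) • Δ' = n • Δ + g := by
    rw [hg, hG, eq_sub_of_add_eq hrec, hr]
    module
  have hQ' : lam • (s - Δ) + (n - 1) • Δ' + (n - 1 + r + 1) • V' =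
      lam • s + n • Δ + (n + r + 1) • V + (a • Δ + b • V) := by
    rw [eq_sub_of_add_eq hrec, ha, hb, hr]
    module
  have hgV : g = G + (n + r) • ((W - W') + (V - W) - (V' - W')) := by rw [hg]; congr 2; abel
  have hanchor := energy_anchor_step lam a b n r (by positivity) s Δ V
  have hvel := energy_velocity_step (n + r) (n • Δ) G g (W - W') (V - W) (V' - W') hgV
  have hDG : ⟪n • Δ, G⟫ = n * ((α - 1) * ‖Δ‖ ^ 2 + c * ⟪Δ, V⟫) := by
    rw [hG, real_inner_smul_left, inner_add_right, real_inner_smul_right, real_inner_smul_right,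
      real_inner_self_eq_norm_sq]
  have hDW : 0 ≤ (n + r) * ⟪n • Δ, W - W'⟫ := by rw [real_inner_smul_left]; positivity
  have hge : -((n + r - 1) * ⟪g, V' - W'⟫) ≤ θ * (‖g‖ * ((n - 1 + r) * ‖dV'‖)) := by
    have h1 : -⟪g, V' - W'⟫ ≤ ‖g‖ * ‖V' - W'‖ := by
      linarith [neg_le_of_abs_le (abs_real_inner_le_norm g (V' - W'))]
    have h2 := mul_le_mul_of_nonneg_left herr' (norm_nonneg g)
    have h3 := mul_le_mul_of_nonneg_left (h1.trans h2) (by linarith : 0 ≤ n + r - 1)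
    linarith
  have hDe : ⟪n • Δ, V' - W'⟫ ≤ ‖Δ‖ * ((n - 1 + r) * ‖dV'‖) := by
    rw [real_inner_smul_left]
    have h1 := mul_le_mul_of_nonneg_left
      ((real_inner_le_norm Δ (V' - W')).trans
        (mul_le_mul_of_nonneg_left herr' (norm_nonneg Δ))) hn0.le
    have h2 : n * θ ≤ n - 1 + r := by nlinarith only [hn, hθ, hr0]
    have h3 := mul_le_mul_of_nonneg_right h2 (mul_nonneg (norm_nonneg Δ) (norm_nonneg dV'))
    linarith
  have hz : (n + r) * ‖V - V'‖ ≤ ‖g‖ + ‖G‖ := by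
    have h1 : (n + r) • (V - V') = g - G := by rw [hg]; abel
    have h2 := norm_sub_le g G
    rwa [← h1, norm_smul, Real.norm_of_nonneg (by linarith)] at h2
  have hverr := velocity_error_le (x := ‖Δ‖) (y := (n - 1 + r) * ‖dV'‖) hθ0 hθ
    (mul_nonneg (by linarith) (norm_nonneg _)) hz
  rw [← hδ] at hverr
  have hGsq : ‖G‖ ^ 2 ≤ 2 * α ^ 2 * (‖Δ‖ ^ 2 + ‖V‖ ^ 2) := by
    have h1 : ‖G‖ ≤ (α - 1) * ‖Δ‖ + c * ‖V‖ := by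
      rw [hG]
      refine (norm_add_le _ _).trans ?_
      rw [norm_smul, norm_smul, Real.norm_of_nonneg (by linarith), Real.norm_of_nonneg (by linarith)]
    have h2 : ‖G‖ ≤ α * (‖Δ‖ + ‖V‖) := by
      nlinarith only [norm_nonneg Δ, mul_nonneg (by linarith : 0 ≤ α - c) (norm_nonneg V), h1]
    have h3 : ‖G‖ ^ 2 ≤ (α * (‖Δ‖ + ‖V‖)) ^ 2 := pow_le_pow_left₀ (norm_nonneg _) h2 2
    nlinarith only [h3, mul_nonneg (sq_nonneg α) (sq_nonneg (‖Δ‖ - ‖V‖))]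
  have hrest : μ * ((1 / δ + 1) * (‖Δ‖ ^ 2 + ‖G‖ ^ 2)) + (r + 1) * a * (‖Δ‖ * ‖V‖)
      ≤ C₁ * (‖Δ‖ ^ 2 + ‖V‖ ^ 2) := by
    have h1 : ‖Δ‖ ^ 2 + ‖G‖ ^ 2 ≤ (1 + 2 * α ^ 2) * (‖Δ‖ ^ 2 + ‖V‖ ^ 2) := by
      nlinarith only [sq_nonneg ‖V‖, hGsq]
    have h2 := mul_le_mul_of_nonneg_left h1 (by positivity : 0 ≤ μ * (1 / δ + 1))
    have h3 : (r + 1) * a * (‖Δ‖ * ‖V‖) ≤ (r + 1) * a * ((‖Δ‖ ^ 2 + ‖V‖ ^ 2) / 2) :=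
      mul_le_mul_of_nonneg_left (by nlinarith only [sq_nonneg (‖Δ‖ - ‖V‖)]) (by positivity)
    rw [hC₁]
    linarith only [h2, h3]
  have hserr : -(lam * b * ⟪s, V⟫) ≤ -(lam * b * ⟪s, W⟫)
      + (μ * δ / 8 * (n ^ 2 * ‖V - V'‖ ^ 2) + C₂ * (‖s‖ ^ 2 / n ^ 2)) := by
    have h1 : -⟪s, V - W⟫ ≤ ‖s‖ * (θ * ‖V - V'‖) := by
      have := neg_le_of_abs_le (abs_real_inner_le_norm s (V - W))
      have := mul_le_mul_of_nonneg_left herr (norm_nonneg s)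
      linarith
    rw [inner_sub_right] at h1
    have h2 := mul_le_mul_of_nonneg_left h1 (by positivity : 0 ≤ lam * b)
    have h3 : μ * δ / 8 * (n ^ 2 * ‖V - V'‖ ^ 2) + C₂ * (‖s‖ ^ 2 / n ^ 2)
        - lam * b * (‖s‖ * (θ * ‖V - V'‖)) =
        (μ * δ * n ^ 2 * ‖V - V'‖ - 4 * lam * b * θ * ‖s‖) ^ 2 / (8 * μ * δ * n ^ 2) := by
      rw [hC₂]; field_simp; ring
    have h4 : 0 ≤ (μ * δ * n ^ 2 * ‖V - V'‖ - 4 * lam * b * θ * ‖s‖) ^ 2 / (8 * μ * δ * n ^ 2) := by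
      positivity
    linarith
  have hquad' : n * (ε₀ * (‖Δ‖ ^ 2 + ‖V‖ ^ 2)) ≤ n * ((a + μ * (α - 1)) * ‖Δ‖ ^ 2
      + (a + b + μ * c) * ⟪Δ, V⟫ + b * ‖V‖ ^ 2) := by
    refine mul_le_mul_of_nonneg_left ((hquad ‖Δ‖ ‖V‖).trans ?_) hn0.le
    have h1 := neg_le_of_abs_le (abs_real_inner_le_norm Δ V)
    have h2 : 0 ≤ a + b + μ * c := by positivity
    nlinarith only [mul_le_mul_of_nonneg_left h1 h2]
  have hcross : -((r + 1) * a * ⟪Δ, V⟫) ≤ (r + 1) * a * (‖Δ‖ * ‖V‖) := by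
    have h1 := neg_le_of_abs_le (abs_real_inner_le_norm Δ V)
    have := mul_le_mul_of_nonneg_left h1 (by positivity : 0 ≤ (r + 1) * a)
    linarith
  have hbV : 0 ≤ (r + 1) * b * ‖V‖ ^ 2 := by positivity
  have hz2 : n ^ 2 * ‖V - V'‖ ^ 2 ≤ ((n + r) * ‖V - V'‖) ^ 2 := by
    rw [← mul_pow]
    exact pow_le_pow_left₀ (by positivity)
      (mul_le_mul_of_nonneg_right (by linarith) (norm_nonneg _)) 2
  have hz3 := mul_le_mul_of_nonneg_left hz2 (by positivity : 0 ≤ μ * δ / 4)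
  have hvelμ := congrArg (μ * ·) hvel
  have hverrμ := mul_le_mul_of_nonneg_left (add_le_add (add_le_add hge hDe) hverr) hμ.le
  have hDWμ := mul_nonneg hμ.le hDW
  rw [hDG] at hvelμ
  have hε1 : min ε₀ (μ * δ / 8) * (n * (‖Δ‖ ^ 2 + ‖V‖ ^ 2)) ≤ ε₀ * (n * (‖Δ‖ ^ 2 + ‖V‖ ^ 2)) :=
    mul_le_mul_of_nonneg_right (min_le_left _ _) (by positivity)
  have hε2 : min ε₀ (μ * δ / 8) * (n ^ 2 * ‖V - V'‖ ^ 2) ≤ μ * δ / 8 * (n ^ 2 * ‖V - V'‖ ^ 2) :=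
    mul_le_mul_of_nonneg_right (min_le_right _ _) (by positivity)
  have hC1 : 0 ≤ C₁ * (‖s‖ ^ 2 / n ^ 2) := by positivity
  have hC2 : 0 ≤ C₂ * (‖Δ‖ ^ 2 + ‖V‖ ^ 2) := by positivity
  unfold fastEnergy
  rw [hQ', hD']
  linarith only [hanchor, hvelμ, hverrμ, hDWμ, hrest, hserr, hquad', hcross, hbV, hz3, hε1, hε2, hC1, hC2]


/-- The weight `μ` of the velocity part of the energy can be chosen so that the energy decreases
for two different values of the anchor weight `lam`. -/
lemma exists_energy_parameters {α c : ℝ} (hc : 1 < c) (hcα : c < α - 1) :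
    ∃ μ lam₁ lam₂ : ℝ, 0 < μ ∧ lam₁ ≠ lam₂ ∧ ∀ lam, lam = lam₁ ∨ lam = lam₂ →
      0 < lam ∧ lam < α - 1 ∧ (α - 1 - lam + (c - 1) + μ * c) ^ 2
        < 4 * (α - 1 - lam + μ * (α - 1)) * (c - 1) := by
  obtain ⟨b, hb⟩ : ∃ b, b = c - 1 := ⟨_, rfl⟩
  obtain ⟨ρ, hρ⟩ : ∃ ρ, ρ = α - 1 - c := ⟨_, rfl⟩
  have hb0 : 0 < b := by linarith
  have hρ0 : 0 < ρ := by linarith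
  obtain ⟨μ, hμ⟩ : ∃ μ, μ = min (1 / 2) (b * ρ / (1 + c) ^ 2) := ⟨_, rfl⟩
  have hμ0 : 0 < μ := by rw [hμ]; positivity
  have hμ1 : μ ≤ 1 / 2 := by rw [hμ]; exact min_le_left _ _
  have hμ2 : μ * (1 + c) ^ 2 ≤ b * ρ := by
    rw [← le_div_iff₀ (by positivity), hμ]; exact min_le_right _ _
  have hbρ := mul_pos hb0 hρ0
  refine ⟨μ, α - c, α - c - μ, hμ0, by linarith, ?_⟩
  have hα : α = ρ + 1 + c := by linarith
  have hcb : c = b + 1 := by linarith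
  have h1 := mul_le_mul_of_nonneg_left hμ2 hμ0.le
  have h2 := mul_pos hμ0 hbρ
  rintro lam (rfl | rfl)
  · refine ⟨by linarith, by linarith, ?_⟩
    subst hα hcb
    nlinarith [sq_nonneg μ, mul_nonneg (sq_nonneg μ) hb0.le]
  · refine ⟨by linarith, by linarith, ?_⟩
    subst hα hcb
    nlinarith

section Sequences

variable {z V W : ℕ → E} {zs : E} {α c θ : ℝ}

lemma fastEnergy_tendsto {lam μ : ℝ} (hc : 1 < c) (hcα : c < α - 1) (hθ0 : 0 ≤ θ)
    (hθ : θ < 1 / 2) (hlam : 0 < lam) (hlamα : lam < α - 1) (hμ : 0 < μ)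
    (hdisc : (α - 1 - lam + (c - 1) + μ * c) ^ 2
      < 4 * (α - 1 - lam + μ * (α - 1)) * (c - 1))
    (hrec : ∀ k : ℕ, ((k : ℝ) + 1) • (z (k + 1) - z k) + ((k : ℝ) + 1 + α - c) • V (k + 1)
      = ((k : ℝ) + 1 + α) • (z (k + 2) - z (k + 1) + V (k + 2)))
    (herr : ∀ k : ℕ, ‖V (k + 2) - W (k + 2)‖ ≤ θ * ‖V (k + 2) - V (k + 1)‖)
    (hmono : ∀ k : ℕ, 0 ≤ ⟪z (k + 3) - z (k + 2), W (k + 3) - W (k + 2)⟫)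
    (hsol : ∀ k : ℕ, 0 ≤ ⟪z (k + 2) - zs, W (k + 2)⟫) :
    (∃ l, Tendsto (fun k : ℕ => fastEnergy lam (α - 1 - lam) μ (α - c - 1) ((k : ℝ) + 2)
      (z (k + 2) - zs) (z (k + 2) - z (k + 1)) (V (k + 2)) (V (k + 2) - W (k + 2))
      (V (k + 2) - V (k + 1))) atTop (nhds l)) ∧
    (∃ B, ∀ k, ‖z (k + 2) - zs‖ ≤ B) ∧
    Summable (fun k : ℕ => ⟪z (k + 3) - zs, W (k + 3)⟫) ∧
    Summable (fun k : ℕ => ((k : ℝ) + 3) * (‖z (k + 3) - z (k + 2)‖ ^ 2 + ‖V (k + 3)‖ ^ 2)) ∧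
    Summable (fun k : ℕ => ((k : ℝ) + 3) ^ 2 * ‖V (k + 3) - V (k + 2)‖ ^ 2) := by
  obtain ⟨ε, hε, C, hC, hstep⟩ :=
    fastEnergy_step (E := E) hc hcα hθ0 hθ hlam hlamα hμ hdisc
  have ha : 0 < α - 1 - lam := by linarith
  have hb : 0 < c - 1 := by linarith
  have hla : 0 < lam * (α - 1 - lam) := mul_pos hlam ha
  obtain ⟨En, hEn⟩ : ∃ En : ℕ → ℝ, En = fun k : ℕ => fastEnergy lam (α - 1 - lam) μ (α - c - 1)
      ((k : ℝ) + 2) (z (k + 2) - zs) (z (k + 2) - z (k + 1)) (V (k + 2)) (V (k + 2) - W (k + 2))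
      (V (k + 2) - V (k + 1)) := ⟨_, rfl⟩
  rw [← hEn]
  have hlow : ∀ k, 1 / 2 * (lam * (α - 1 - lam)) * ‖z (k + 2) - zs‖ ^ 2 ≤ En k := by
    intro k
    rw [hEn, ← mul_assoc]
    exact le_fastEnergy hμ.le (by have := (Nat.cast_nonneg k : (0 : ℝ) ≤ k); linarith) hθ (herr k)
  have hEn0 : ∀ k, 0 ≤ En k := fun k => le_trans (by positivity) (hlow k)
  let T : ℕ → ℝ := fun k => lam * (c - 1) * ⟪z (k + 3) - zs, W (k + 3)⟫
    + ε / 2 * (((k : ℝ) + 3) * (‖z (k + 3) - z (k + 2)‖ ^ 2 + ‖V (k + 3)‖ ^ 2))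
    + ε * (((k : ℝ) + 3) ^ 2 * ‖V (k + 3) - V (k + 2)‖ ^ 2)
  have hT1 : ∀ k : ℕ, 0 ≤ lam * (c - 1) * ⟪z (k + 3) - zs, W (k + 3)⟫ := fun k =>
    mul_nonneg (by positivity) (hsol (k + 1))
  have hT2 : ∀ k : ℕ, 0 ≤ ε / 2 *
      (((k : ℝ) + 3) * (‖z (k + 3) - z (k + 2)‖ ^ 2 + ‖V (k + 3)‖ ^ 2)) :=
    fun k => by positivity
  have hT3 : ∀ k : ℕ, 0 ≤ ε * (((k : ℝ) + 3) ^ 2 * ‖V (k + 3) - V (k + 2)‖ ^ 2) :=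
    fun k => by positivity
  have hT : ∀ k, 0 ≤ T k := fun k => add_nonneg (add_nonneg (hT1 k) (hT2 k)) (hT3 k)
  obtain ⟨N, hN⟩ := exists_nat_ge (2 * C / ε)
  rw [div_le_iff₀ hε] at hN
  have hdec : ∀ k ≥ N, En (k + 1) + T k ≤
      En k + (2 * C / (lam * (α - 1 - lam))) / ((k : ℝ) + 1) ^ 2 * En (k + 1) := by
    intro k hk
    have hkN : (N : ℝ) ≤ k := by exact_mod_cast hk
    have hk0 : (0 : ℝ) ≤ k := Nat.cast_nonneg k
    have hr := hrec (k + 1)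
    push_cast at hr
    have h := hstep ((k : ℝ) + 3) (by linarith) (z (k + 3) - zs) (z (k + 3) - z (k + 2))
      (V (k + 3)) (W (k + 3)) (z (k + 2) - z (k + 1)) (V (k + 2)) (W (k + 2))
      (V (k + 2) - V (k + 1))
      (by convert hr using 2 <;> congr 1 <;> ring) (herr (k + 1)) (herr k) (hmono k)
    have e1 : fastEnergy lam (α - 1 - lam) μ (α - c - 1) ((k : ℝ) + 3)
      (z (k + 3) - zs) (z (k + 3) - z (k + 2)) (V (k + 3)) (V (k + 3) - W (k + 3))
      (V (k + 3) - V (k + 2)) = En (k + 1) := by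
      rw [hEn]; simp only; push_cast; congr 1; ring
    have e2 : fastEnergy lam (α - 1 - lam) μ (α - c - 1) ((k : ℝ) + 3 - 1)
      (z (k + 3) - zs - (z (k + 3) - z (k + 2))) (z (k + 2) - z (k + 1)) (V (k + 2))
      (V (k + 2) - W (k + 2)) (V (k + 2) - V (k + 1)) = En k := by
      rw [hEn]; simp only; congr 1
      · ring
      · abel
    rw [e1, e2] at h
    have h1 : ε / 2 * (((k : ℝ) + 3) * (‖z (k + 3) - z (k + 2)‖ ^ 2 + ‖V (k + 3)‖ ^ 2))
        ≤ (ε * ((k : ℝ) + 3) - C) * (‖z (k + 3) - z (k + 2)‖ ^ 2 + ‖V (k + 3)‖ ^ 2) := by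
      rw [← mul_assoc]
      apply mul_le_mul_of_nonneg_right _ (by positivity)
      nlinarith
    have h2 : C * (‖z (k + 3) - zs‖ ^ 2 / ((k : ℝ) + 3) ^ 2) ≤
        (2 * C / (lam * (α - 1 - lam))) / ((k : ℝ) + 1) ^ 2 * En (k + 1) := by
      calc C * (‖z (k + 3) - zs‖ ^ 2 / ((k : ℝ) + 3) ^ 2)
          ≤ C * (‖z (k + 3) - zs‖ ^ 2 / ((k : ℝ) + 1) ^ 2) := by gcongr; norm_num
        _ = (2 * C / (lam * (α - 1 - lam))) / ((k : ℝ) + 1) ^ 2 *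
            (1 / 2 * (lam * (α - 1 - lam)) * ‖z (k + 1 + 2) - zs‖ ^ 2) := by
          field_simp
        _ ≤ _ := mul_le_mul_of_nonneg_left (hlow (k + 1)) (by positivity)
    simp only [T]
    linarith
  obtain ⟨⟨l, hl⟩, hsum⟩ := tendsto_and_summable_of_almost_decreasing hEn0 hT (by positivity) hdec
  refine ⟨⟨l, hl⟩, ?_, ?_, ?_, ?_⟩
  · obtain ⟨B, hB⟩ := hl.bddAbove_range
    refine ⟨√(2 * B / (lam * (α - 1 - lam))), fun k => Real.le_sqrt_of_sq_le ?_⟩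
    rw [le_div_iff₀ hla]
    linarith [hlow k, hB ⟨k, rfl⟩]
  · have := hsum.of_nonneg_of_le hT1 fun k => by simp only [T]; linarith [hT2 k, hT3 k]
    exact (summable_mul_left_iff (by positivity)).1 this
  · have := hsum.of_nonneg_of_le hT2 fun k => by simp only [T]; linarith [hT1 k, hT3 k]
    exact (summable_mul_left_iff (by positivity)).1 this
  · have := hsum.of_nonneg_of_le hT3 fun k => by simp only [T]; linarith [hT1 k, hT2 k]
    exact (summable_mul_left_iff (by positivity)).1 this

lemma fastEnergy_sub (lam₁ lam₂ μ r n : ℝ) (s Δ V e dV : E) :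
    fastEnergy lam₁ (α - 1 - lam₁) μ r n s Δ V e dV
      - fastEnergy lam₂ (α - 1 - lam₂) μ r n s Δ V e dV =
    (lam₁ - lam₂) * ((α - 1) * (1 / 2 * ‖s‖ ^ 2) + n * ⟪s, Δ⟫ + (n + r + 1) * ⟪s, V⟫) := by
  unfold fastEnergy
  rw [add_assoc (lam₁ • s), add_assoc (lam₂ • s), norm_add_sq_real (lam₁ • s),
    norm_add_sq_real (lam₂ • s)]
  simp only [norm_smul, inner_add_right, real_inner_smul_left, real_inner_smul_right, mul_pow,
    Real.norm_eq_abs, sq_abs]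
  ring

lemma norm_sub_tendsto_of_fast_scheme (hc : 1 < c) (hcα : c < α - 1) (hθ0 : 0 ≤ θ)
    (hθ : θ < 1 / 2)
    (hrec : ∀ k : ℕ, ((k : ℝ) + 1) • (z (k + 1) - z k) + ((k : ℝ) + 1 + α - c) • V (k + 1)
      = ((k : ℝ) + 1 + α) • (z (k + 2) - z (k + 1) + V (k + 2)))
    (herr : ∀ k : ℕ, ‖V (k + 2) - W (k + 2)‖ ≤ θ * ‖V (k + 2) - V (k + 1)‖)
    (hmono : ∀ k : ℕ, 0 ≤ ⟪z (k + 3) - z (k + 2), W (k + 3) - W (k + 2)⟫)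
    (hsol : ∀ k : ℕ, 0 ≤ ⟪z (k + 2) - zs, W (k + 2)⟫) :
    (∃ l, Tendsto (fun k => ‖z k - zs‖) atTop (nhds l)) ∧ Tendsto V atTop (nhds 0) := by
  obtain ⟨μ, lam₁, lam₂, hμ, hne, hpar⟩ := exists_energy_parameters hc hcα
  obtain ⟨h1a, h1b, h1c⟩ := hpar lam₁ (Or.inl rfl)
  obtain ⟨h2a, h2b, h2c⟩ := hpar lam₂ (Or.inr rfl)
  obtain ⟨⟨l₁, hl₁⟩, ⟨B, hB⟩, hsumW, hsumV, hsumdV⟩ :=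
    fastEnergy_tendsto hc hcα hθ0 hθ h1a h1b hμ h1c hrec herr hmono hsol
  obtain ⟨⟨l₂, hl₂⟩, -⟩ :=
    fastEnergy_tendsto hc hcα hθ0 hθ h2a h2b hμ h2c hrec herr hmono hsol
  have hlim0 := hsumV.tendsto_atTop_zero
  have hΔlim : Tendsto (fun k : ℕ => ((k : ℝ) + 1) * ‖z (k + 3) - z (k + 2)‖ ^ 2) atTop
      (nhds 0) := by
    refine squeeze_zero (fun k => by positivity) (fun k => ?_) hlim0
    gcongr
    · norm_num
    · exact le_add_of_nonneg_right (sq_nonneg _)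
  have hΔ0 : Tendsto (fun k : ℕ => ‖z (k + 3) - z (k + 2)‖) atTop (nhds 0) := by
    have : Tendsto (fun k : ℕ => ‖z (k + 3) - z (k + 2)‖ ^ 2) atTop (nhds 0) := by
      refine squeeze_zero (fun k => by positivity) (fun k => ?_) hΔlim
      nlinarith [sq_nonneg ‖z (k + 3) - z (k + 2)‖, (Nat.cast_nonneg k : (0 : ℝ) ≤ k)]
    simpa using this.sqrt
  have hV0 : Tendsto (fun k : ℕ => ‖V (k + 3)‖) atTop (nhds 0) := by
    have : Tendsto (fun k : ℕ => ‖V (k + 3)‖ ^ 2) atTop (nhds 0) := by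
      refine squeeze_zero (fun k => by positivity) (fun k => ?_) hlim0
      have hk := (Nat.cast_nonneg k : (0 : ℝ) ≤ k)
      nlinarith [sq_nonneg ‖z (k + 3) - z (k + 2)‖, sq_nonneg ‖V (k + 3)‖,
        mul_nonneg hk (sq_nonneg ‖z (k + 3) - z (k + 2)‖), mul_nonneg hk (sq_nonneg ‖V (k + 3)‖)]
    simpa using this.sqrt
  have hB0 : 0 ≤ B := (norm_nonneg _).trans (hB 0)
  have hinner0 : ∀ q : ℕ → E, Tendsto (fun k => ‖q k‖) atTop (nhds 0) →
      Tendsto (fun k : ℕ => ⟪z (k + 3) - zs, q k⟫) atTop (nhds 0) := by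
    intro q hq
    have := hq.const_mul B
    rw [mul_zero] at this
    refine squeeze_zero_norm (fun k => ?_) this
    exact (abs_real_inner_le_norm _ _).trans
      (mul_le_mul_of_nonneg_right (hB (k + 1)) (norm_nonneg _))
  have hsΔ := hinner0 (fun k => z (k + 3) - z (k + 2)) hΔ0
  have hsV := hinner0 (fun k => V (k + 3)) hV0
  have hsumσ : Summable fun k : ℕ => ⟪z (k + 3) - zs, V (k + 3)⟫ := by
    have hinv : Summable fun k : ℕ => 1 / ((k : ℝ) + 3) ^ 2 := by
      have := (summable_nat_add_iff 3).2 (Real.summable_one_div_nat_pow.2 one_lt_two)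
      simpa using this
    have herrsum : Summable fun k : ℕ => ⟪z (k + 3) - zs, V (k + 3) - W (k + 3)⟫ := by
      refine Summable.of_norm_bounded ((hsumdV.add hinv).mul_left B) fun k => ?_
      rw [Real.norm_eq_abs]
      refine (abs_real_inner_le_norm _ _).trans
        (mul_le_mul (hB (k + 1)) ((herr (k + 1)).trans ?_) (norm_nonneg _) hB0)
      have hk : 0 < (k : ℝ) + 3 := by positivity
      have h1 : ((k : ℝ) + 3) ^ 2 * ‖V (k + 3) - V (k + 2)‖ ^ 2 + 1 / ((k : ℝ) + 3) ^ 2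
          - 2 * ‖V (k + 3) - V (k + 2)‖ =
          (((k : ℝ) + 3) * ‖V (k + 3) - V (k + 2)‖ - 1 / ((k : ℝ) + 3)) ^ 2 := by
        field_simp; ring
      have h2 := sq_nonneg (((k : ℝ) + 3) * ‖V (k + 3) - V (k + 2)‖ - 1 / ((k : ℝ) + 3))
      rw [← h1] at h2
      have h3 : ‖V (k + 1 + 2) - V (k + 1 + 1)‖ = ‖V (k + 3) - V (k + 2)‖ := rfl
      rw [h3]
      nlinarith [norm_nonneg (V (k + 3) - V (k + 2))]
    refine (herrsum.add hsumW).congr fun k => ?_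
    rw [← inner_add_right, sub_add_cancel]
  obtain ⟨S, hS⟩ : ∃ S : ℕ → ℝ,
    S = fun k => ∑ j ∈ Finset.range k, ⟪z (j + 3) - zs, V (j + 3)⟫ := ⟨_, rfl⟩
  obtain ⟨S', hS'⟩ : ∃ S', Tendsto S atTop (nhds S') := by
    rw [hS]; exact ⟨_, hsumσ.hasSum.tendsto_sum_nat⟩
  have hSsucc : ∀ k, S (k + 1) = S k + ⟪z (k + 3) - zs, V (k + 3)⟫ := fun k => by
    rw [hS]; exact Finset.sum_range_succ _ _
  obtain ⟨φ, hφ⟩ : ∃ φ : ℕ → ℝ, φ = fun k => 1 / 2 * ‖z (k + 2) - zs‖ ^ 2 := ⟨_, rfl⟩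
  have hφsucc : ∀ k, φ (k + 1) - φ k =
      ⟪z (k + 3) - zs, z (k + 3) - z (k + 2)⟫ - 1 / 2 * ‖z (k + 3) - z (k + 2)‖ ^ 2 := by
    intro k
    have h1 := norm_sub_sq_real (z (k + 3) - zs) (z (k + 3) - z (k + 2))
    rw [show z (k + 3) - zs - (z (k + 3) - z (k + 2)) = z (k + 2) - zs by abel] at h1
    have h2 : φ (k + 1) = 1 / 2 * ‖z (k + 3) - zs‖ ^ 2 := by rw [hφ]
    have h3 : φ k = 1 / 2 * ‖z (k + 2) - zs‖ ^ 2 := by rw [hφ]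
    linarith
  have hdiff := ((tendsto_add_atTop_iff_nat 1).2 (hl₁.sub hl₂)).const_mul (lam₁ - lam₂)⁻¹
  simp only [fastEnergy_sub, inv_mul_cancel_left₀ (sub_ne_zero.2 hne)] at hdiff
  generalize (lam₁ - lam₂)⁻¹ * (l₁ - l₂) = L at hdiff
  have hα1 : 0 < α - 1 := by linarith
  have hmain : Tendsto (fun k => (φ k + S k) - (L + (α - 1) * S') / (α - 1)) atTop (nhds 0) := by
    apply tendsto_zero_of_add_mul_sub_tendsto_zero (τ := α - 1) (by linarith)
    have := ((((hdiff.add (((tendsto_add_atTop_iff_nat 1).2 hS').const_mul (α - 1))).sub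
      (hsΔ.const_mul 2)).sub (hΔlim.const_mul (1 / 2))).sub
      (hsV.const_mul (α - c + 2))).sub_const (L + (α - 1) * S')
    convert this using 2 with k
    · have h1 := hφsucc k
      have h2 := hSsucc k
      have h3 : φ (k + 1) = 1 / 2 * ‖z (k + 1 + 2) - zs‖ ^ 2 := by rw [hφ]
      rw [← h3]
      have h4 : (α - 1) * ((L + (α - 1) * S') / (α - 1)) = L + (α - 1) * S' := by field_simp
      rw [mul_sub, h4]
      push_cast
      linear_combination ((k : ℝ) + 1) * h1 + ((k : ℝ) + 1) * h2
    · ring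
  have hφlim := (hmain.add_const ((L + (α - 1) * S') / (α - 1))).sub hS'
  refine ⟨?_, ?_⟩
  · refine ⟨_, (tendsto_add_atTop_iff_nat 2).1 (((hφlim.const_mul 2).sqrt).congr fun k => ?_)⟩
    rw [hφ]
    simp only
    rw [show 2 * (1 / 2 * ‖z (k + 2) - zs‖ ^ 2 + S k - (L + (α - 1) * S') / (α - 1)
      + (L + (α - 1) * S') / (α - 1) - S k) = ‖z (k + 2) - zs‖ ^ 2 by ring]
    exact Real.sqrt_sq (norm_nonneg _)
  · exact (tendsto_add_atTop_iff_nat 3).1 (tendsto_zero_iff_norm_tendsto_zero.2 hV0)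

end Sequences

end Energy

section WeakLimits

variable {E : Type*} [NormedAddCommGroup E] [InnerProductSpace ℝ E]

lemma tendsto_inner_zero_of_bounded {ι : Type*} {U : Filter ι} {w s : ι → E} {B : ℝ}
    (hw : Tendsto w U (nhds 0)) (hs : ∀ k, ‖s k‖ ≤ B) :
    Tendsto (fun k => ⟪w k, s k⟫) U (nhds 0) := by
  have h := (tendsto_zero_iff_norm_tendsto_zero.1 hw).mul_const B
  rw [zero_mul] at h
  refine squeeze_zero_norm (fun k => ?_) h
  exact (abs_real_inner_le_norm _ _).trans (mul_le_mul_of_nonneg_left (hs k) (norm_nonneg _))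

lemma ConvexOn.sub_le_of_mem_Ioc {f : E → ℝ} (hf : ConvexOn ℝ Set.univ f) (x d : E) {t : ℝ}
    (ht0 : 0 < t) (ht1 : t ≤ 1) : t⁻¹ * (f (x + t • d) - f x) ≤ f (x + d) - f x := by
  have h1 := hf.2 (Set.mem_univ x) (Set.mem_univ (x + d)) (by linarith : 0 ≤ 1 - t) ht0.le
    (by ring)
  rw [show (1 - t) • x + t • (x + d) = x + t • d by module] at h1
  simp only [smul_eq_mul] at h1
  rw [inv_mul_le_iff₀ ht0]
  linarith

variable [CompleteSpace E]

lemma exists_weak_limit_of_bounded {ι : Type*} (U : Ultrafilter ι) {z : ι → E} {B : ℝ}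
    (hB : ∀ k, ‖z k‖ ≤ B) :
    ∃ zb : E, ∀ p, Tendsto (fun k => ⟪z k, p⟫) U (nhds ⟪zb, p⟫) := by
  let g : ι → WeakDual ℝ E := fun k => StrongDual.toWeakDual (InnerProductSpace.toDual ℝ E (z k))
  obtain ⟨L, -, hL⟩ := (WeakDual.isCompact_closedBall (𝕜 := ℝ) (E := E) 0 B).ultrafilter_le_nhds
    (U.map g) (by
      rw [le_principal_iff, Ultrafilter.mem_coe, Ultrafilter.mem_map]
      refine Filter.univ_mem' fun k => ?_
      simp only [Set.mem_preimage, Metric.mem_closedBall, dist_zero_right, g]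
      rw [show WeakDual.toStrongDual (StrongDual.toWeakDual (InnerProductSpace.toDual ℝ E (z k)))
        = InnerProductSpace.toDual ℝ E (z k) from rfl, LinearIsometryEquiv.norm_map]
      exact hB k)
  refine ⟨(InnerProductSpace.toDual ℝ E).symm (WeakDual.toStrongDual L), fun p => ?_⟩
  have h1 : Tendsto g U (nhds L) := hL
  have h2 := ((WeakDual.eval_continuous (𝕜 := ℝ) p).tendsto L).comp h1
  rw [InnerProductSpace.toDual_symm_apply]
  exact h2

/-- Opial's lemma. -/
lemma exists_weak_limit_of_opial {z : ℕ → E} {S : Set E} (hne : S.Nonempty)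
    (hS : ∀ p ∈ S, ∃ l, Tendsto (fun k => ‖z k - p‖) atTop (nhds l))
    (hcl : ∀ U : Ultrafilter ℕ, (U : Filter ℕ) ≤ atTop → ∀ zb,
      (∀ p, Tendsto (fun k => ⟪z k, p⟫) U (nhds ⟪zb, p⟫)) → zb ∈ S) :
    ∃ zb ∈ S, ∀ p, Tendsto (fun k => ⟪z k, p⟫) atTop (nhds ⟪zb, p⟫) := by
  obtain ⟨B, hB⟩ : ∃ B, ∀ k, ‖z k‖ ≤ B := by
    obtain ⟨p, hp⟩ := hne
    obtain ⟨l, hl⟩ := hS p hp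
    obtain ⟨B, hB⟩ := hl.bddAbove_range
    refine ⟨B + ‖p‖, fun k => ?_⟩
    have h1 := hB ⟨k, rfl⟩
    have h2 := norm_sub_norm_le (z k) p
    simp only at h1
    linarith
  have huniq : ∀ U U' : Ultrafilter ℕ, (U : Filter ℕ) ≤ atTop → (U' : Filter ℕ) ≤ atTop →
      ∀ a a' : E, (∀ p, Tendsto (fun k => ⟪z k, p⟫) U (nhds ⟪a, p⟫)) →
      (∀ p, Tendsto (fun k => ⟪z k, p⟫) U' (nhds ⟪a', p⟫)) → a = a' := by
    intro U U' hU hU' a a' ha ha'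
    obtain ⟨l, hl⟩ := hS a (hcl U hU a ha)
    obtain ⟨l', hl'⟩ := hS a' (hcl U' hU' a' ha')
    have hlim : Tendsto (fun k => ⟪z k, a' - a⟫) atTop
        (nhds ((l ^ 2 - l' ^ 2 - ‖a‖ ^ 2 + ‖a'‖ ^ 2) / 2)) := by
      refine (((((hl.pow 2).sub (hl'.pow 2)).sub_const (‖a‖ ^ 2)).add_const
        (‖a'‖ ^ 2)).div_const 2).congr fun k => ?_
      rw [norm_sub_sq_real, norm_sub_sq_real, inner_sub_right]
      ring
    have h1 := tendsto_nhds_unique (ha (a' - a)) (hlim.mono_left hU)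
    have h2 := tendsto_nhds_unique (ha' (a' - a)) (hlim.mono_left hU')
    have h3 : ⟪a' - a, a' - a⟫ = 0 := by rw [inner_sub_left]; linarith
    exact (sub_eq_zero.1 (inner_self_eq_zero.1 h3)).symm
  obtain ⟨zb, hzb⟩ := exists_weak_limit_of_bounded (Ultrafilter.of (atTop : Filter ℕ)) hB
  refine ⟨zb, hcl _ (Ultrafilter.of_le _) zb hzb, fun p => ?_⟩
  rw [tendsto_iff_ultrafilter]
  intro U hU
  obtain ⟨a, ha⟩ := exists_weak_limit_of_bounded U hB
  rw [huniq _ U (Ultrafilter.of_le _) hU zb a hzb ha]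
  exact ha p

lemma eventually_lt_of_weak_tendsto {ι : Type*} {U : Filter ι} {G : E → ℝ}
    (hG : ConvexOn ℝ Set.univ G) (hGlsc : LowerSemicontinuous G) {x : ι → E} {xb : E}
    (hx : ∀ p, Tendsto (fun k => ⟪x k, p⟫) U (nhds ⟪xb, p⟫)) {r : ℝ} (hr : r < G xb) :
    ∀ᶠ k in U, r < G (x k) := by
  have hconv : Convex ℝ (G ⁻¹' Set.Iic r) := by
    have := hG.convex_le r
    simpa [Set.preimage] using this
  obtain ⟨g, u, hu1, hu2⟩ := geometric_hahn_banach_point_closed hconv (hGlsc.isClosed_preimage r)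
    (x := xb) (by simpa using hr)
  have hg : ∀ y, g y = ⟪y, (InnerProductSpace.toDual ℝ E).symm g⟫ := fun y => by
    rw [real_inner_comm, InnerProductSpace.toDual_symm_apply]
  have hlim := hx ((InnerProductSpace.toDual ℝ E).symm g)
  rw [← hg] at hlim
  filter_upwards [hlim.eventually_lt_const hu1] with k hk
  by_contra! hcon
  have := hu2 (x k) hcon
  rw [hg] at this
  linarith

lemma HasGradientAt.tendsto_slope {h : E → ℝ} {g x : E} (hg : HasGradientAt h g x) (d : E) :
    Tendsto (fun t : ℝ => t⁻¹ * (h (x + t • d) - h x)) (nhdsWithin 0 (Set.Ioi 0))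
      (nhds ⟪g, d⟫) := by
  have h1 : HasFDerivAt h (InnerProductSpace.toDual ℝ E g) (x + (0 : ℝ) • d) := by
    simpa using hg.hasFDerivAt
  have h2 : HasDerivAt (fun t : ℝ => x + t • d) d 0 := by
    simpa using ((hasDerivAt_id (0 : ℝ)).smul_const d).const_add x
  have h3 := (h1.comp_hasDerivAt (0 : ℝ) h2).tendsto_slope_zero_right
  simpa using h3

lemma ConvexOn.add_inner_le_of_hasGradientAt {h : E → ℝ} (hh : ConvexOn ℝ Set.univ h) {g x : E}
    (hg : HasGradientAt h g x) (y : E) : h x + ⟪g, y - x⟫ ≤ h y := by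
  have h1 := hg.tendsto_slope (y - x)
  have h2 : ⟪g, y - x⟫ ≤ h (x + (y - x)) - h x := by
    refine le_of_tendsto h1 ?_
    filter_upwards [Ioc_mem_nhdsGT (zero_lt_one' ℝ)] with t ht
    exact hh.sub_le_of_mem_Ioc x _ ht.1 ht.2
  rw [add_sub_cancel] at h2
  linarith

/-- First-order optimality for minimizing `f + h` plus a linear term, with `h` smooth. -/
lemma ConvexOn.add_inner_le_of_isMinimizer {f h : E → ℝ} (hf : ConvexOn ℝ Set.univ f) {g q x : E}
    (hg : HasGradientAt h g x) (hmin : ∀ y, f x + h x + ⟪q, x⟫ ≤ f y + h y + ⟪q, y⟫) (y : E) :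
    f x + ⟪-g - q, y - x⟫ ≤ f y := by
  have h1 := ((hg.tendsto_slope (y - x)).add_const (f y - f x + ⟪q, y - x⟫))
  have h2 : 0 ≤ ⟪g, y - x⟫ + (f y - f x + ⟪q, y - x⟫) := by
    refine ge_of_tendsto h1 ?_
    filter_upwards [Ioc_mem_nhdsGT (zero_lt_one' ℝ)] with t ht
    have h3 := hf.sub_le_of_mem_Ioc x (y - x) ht.1 ht.2
    rw [add_sub_cancel] at h3
    have h4 := hmin (x + t • (y - x))
    rw [inner_add_right, real_inner_smul_right] at h4
    have h5 : 0 ≤ t⁻¹ * ((f (x + t • (y - x)) - f x) + (h (x + t • (y - x)) - h x)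
        + t * ⟪q, y - x⟫) := mul_nonneg (inv_nonneg.2 ht.1.le) (by linarith)
    have h6 : t⁻¹ * ((f (x + t • (y - x)) - f x) + (h (x + t • (y - x)) - h x)
        + t * ⟪q, y - x⟫) = t⁻¹ * (f (x + t • (y - x)) - f x)
        + t⁻¹ * (h (x + t • (y - x)) - h x) + ⟪q, y - x⟫ := by
      have := ht.1.ne'
      field_simp
    linarith
  rw [inner_sub_left, inner_neg_left]
  linarith

lemma mem_of_forall_dual_nonneg {K : Set E} (hKne : K.Nonempty) (hKcl : IsClosed K)
    (hKcvx : Convex ℝ K) (hKcone : ∀ t : ℝ, 0 ≤ t → ∀ ζ ∈ K, t • ζ ∈ K) {q : E}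
    (hq : ∀ μ : E, (∀ ζ ∈ K, 0 ≤ ⟪μ, ζ⟫) → 0 ≤ ⟪μ, q⟫) : q ∈ K := by
  by_contra hcon
  obtain ⟨g, u, hu1, hu2⟩ := geometric_hahn_banach_point_closed hKcvx hKcl hcon
  have hu0 : u < 0 := by
    obtain ⟨ζ, hζ⟩ := hKne
    have := hu2 _ (hKcone 0 le_rfl ζ hζ)
    simpa using this
  have h1 := hq ((InnerProductSpace.toDual ℝ E).symm g) fun ζ hζ => by
    rw [InnerProductSpace.toDual_symm_apply]
    by_contra! hneg
    have h2 := hu2 _ (hKcone (u / g ζ) (div_nonneg_of_nonpos hu0.le hneg.le) ζ hζ)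
    rw [map_smul, smul_eq_mul, div_mul_cancel₀ _ hneg.ne] at h2
    exact lt_irrefl _ h2
  rw [InnerProductSpace.toDual_symm_apply] at h1
  linarith

end WeakLimits

section Saddle

variable {X : Type*} [NormedAddCommGroup X] [InnerProductSpace ℝ X] [CompleteSpace X]
  {Y : Type*} [NormedAddCommGroup Y] [InnerProductSpace ℝ Y] [CompleteSpace Y]

lemma saddle_of_weak_limit {ι : Type*} {U : Filter ι} [U.NeBot] {G : X → ℝ}
    (hG : ConvexOn ℝ Set.univ G) (hGlsc : LowerSemicontinuous G) (A : X →L[ℝ] Y) (b : Y)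
    {x w : ι → X} {l ω : ι → Y} {xb : X} {lb : Y} {B : ℝ}
    (hx : ∀ p, Tendsto (fun k => ⟪x k, p⟫) U (nhds ⟪xb, p⟫))
    (hl : ∀ q, Tendsto (fun k => ⟪l k, q⟫) U (nhds ⟪lb, q⟫))
    (hw : Tendsto w U (nhds 0)) (hω : Tendsto ω U (nhds 0))
    (hxB : ∀ k, ‖x k‖ ≤ B) (hlB : ∀ k, ‖l k‖ ≤ B) {x' : X} {μ : Y}
    (hineq : ∀ᶠ k in U, G (x k) + ⟪w k, x' - x k⟫ + ⟪ω k, μ - l k⟫ - ⟪l k, A x'⟫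
      + ⟪A (x k), μ⟫ - ⟪b, μ - l k⟫ ≤ G x') :
    G xb - ⟪lb, A x'⟫ + ⟪A xb, μ⟫ - ⟪b, μ - lb⟫ ≤ G x' := by
  have hAx : Tendsto (fun k => ⟪A (x k), μ⟫) U (nhds ⟪A xb, μ⟫) := by
    have h := hx (ContinuousLinearMap.adjoint A μ)
    simpa only [ContinuousLinearMap.adjoint_inner_right] using h
  have hbl : Tendsto (fun k => ⟪b, μ - l k⟫) U (nhds ⟪b, μ - lb⟫) := by
    have h := (hl b).const_sub ⟪b, μ⟫
    simpa only [inner_sub_right, real_inner_comm b] using h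
  have hw0 : Tendsto (fun k => ⟪w k, x' - x k⟫) U (nhds 0) :=
    tendsto_inner_zero_of_bounded (B := ‖x'‖ + B) hw fun k =>
      (norm_sub_le _ _).trans (by linarith [hxB k])
  have hω0 : Tendsto (fun k => ⟪ω k, μ - l k⟫) U (nhds 0) :=
    tendsto_inner_zero_of_bounded (B := ‖μ‖ + B) hω fun k =>
      (norm_sub_le _ _).trans (by linarith [hlB k])
  have hlim := ((((hw0.add hω0).sub (hl (A x'))).add hAx).sub hbl).const_sub (G x')
  refine le_of_forall_lt_imp_le_of_dense fun r hr => ?_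
  have hr' : r + ⟪lb, A x'⟫ - ⟪A xb, μ⟫ + ⟪b, μ - lb⟫ < G xb := by linarith
  have hev := eventually_lt_of_weak_tendsto hG hGlsc hx hr'
  have h2 := ge_of_tendsto hlim
    (b := r + ⟪lb, A x'⟫ - ⟪A xb, μ⟫ + ⟪b, μ - lb⟫) (by
      filter_upwards [hineq, hev] with k hk1 hk2
      linarith)
  linarith

lemma primal_dual_of_saddle {K : Set Y} (hKne : K.Nonempty) (hKcl : IsClosed K)
    (hKcvx : Convex ℝ K) (hKcone : ∀ t : ℝ, 0 ≤ t → ∀ ζ ∈ K, t • ζ ∈ K) {f h : X → ℝ}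
    (hf : ConvexOn ℝ Set.univ f) (A : X →L[ℝ] Y) (b : Y) {xb g : X} {lb : Y}
    (hg : HasGradientAt h g xb) (hlb : ∀ ζ ∈ K, 0 ≤ ⟪lb, ζ⟫)
    (hsaddle : ∀ x' μ, (∀ ζ ∈ K, 0 ≤ ⟪μ, ζ⟫) →
      f xb + h xb - ⟪lb, A x'⟫ + ⟪A xb, μ⟫ - ⟪b, μ - lb⟫ ≤ f x' + h x') :
    (∀ ζ ∈ K, 0 ≤ ⟪lb, ζ⟫) ∧ A xb - b ∈ -K ∧ ⟪lb, A xb - b⟫ = 0 ∧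
      (∀ x' : X, f xb + ⟪-g - (ContinuousLinearMap.adjoint A) lb, x' - xb⟫ ≤ f x') := by
  have hdual : ∀ μ : Y, (∀ ζ ∈ K, 0 ≤ ⟪μ, ζ⟫) → ⟪μ, A xb - b⟫ ≤ ⟪lb, A xb - b⟫ := by
    intro μ hμ
    have h1 := hsaddle xb μ hμ
    rw [inner_sub_right, inner_sub_right]
    rw [inner_sub_right, real_inner_comm μ (A xb), real_inner_comm μ b,
      real_inner_comm lb b] at h1
    linarith
  have hzero : ⟪lb, A xb - b⟫ = 0 := by
    have h1 := hdual 0 (by simp)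
    have h2 := hdual ((2 : ℝ) • lb) fun ζ hζ => by
      rw [real_inner_smul_left]; linarith [hlb ζ hζ]
    rw [inner_zero_left] at h1
    rw [real_inner_smul_left] at h2
    linarith
  refine ⟨hlb, ?_, hzero, ?_⟩
  · rw [Set.mem_neg]
    refine mem_of_forall_dual_nonneg hKne hKcl hKcvx hKcone fun μ hμ => ?_
    have := hdual μ hμ
    rw [inner_neg_right]
    linarith
  · refine hf.add_inner_le_of_isMinimizer hg fun y => ?_
    have h1 := hsaddle y lb hlb
    rw [sub_self, inner_zero_right] at h1
    rw [ContinuousLinearMap.adjoint_inner_left, ContinuousLinearMap.adjoint_inner_left]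
    rw [real_inner_comm lb (A xb)] at h1
    linarith

lemma lipschitz_operator_bound {L : ℝ} (hL : 0 ≤ L) (A : X →L[ℝ] Y) {g d : X} {e : Y}
    (hg : ‖g‖ ≤ L * ‖d‖) :
    ‖g + ContinuousLinearMap.adjoint A e‖ ^ 2 + ‖A d‖ ^ 2 ≤
      ((L + ‖A‖) ^ 2 + ‖A‖ ^ 2) * (‖d‖ ^ 2 + ‖e‖ ^ 2) := by
  have h1 : ‖g + ContinuousLinearMap.adjoint A e‖ ≤ L * ‖d‖ + ‖A‖ * ‖e‖ := by
    refine (norm_add_le _ _).trans (add_le_add hg ?_)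
    have := (ContinuousLinearMap.adjoint A).le_opNorm e
    rwa [LinearIsometryEquiv.norm_map] at this
  have h2 := pow_le_pow_left₀ (norm_nonneg _) h1 2
  have h3 := pow_le_pow_left₀ (norm_nonneg _) (A.le_opNorm d) 2
  have hA := norm_nonneg A
  have hd := norm_nonneg d
  have he := norm_nonneg e
  nlinarith [sq_nonneg (L * ‖e‖ - ‖A‖ * ‖d‖), mul_nonneg (mul_nonneg hL hA) (sq_nonneg ‖d‖),
    mul_nonneg (mul_nonneg hL hA) (sq_nonneg ‖e‖), mul_nonneg (sq_nonneg ‖A‖) (sq_nonneg ‖e‖)]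

lemma primal_dual_operator_monotone {γ : ℝ} (hγ : 0 ≤ γ) (A : X →L[ℝ] Y) (b : Y)
    {x₁ x₂ u₁ u₂ g₁ g₂ : X} {l₁ l₂ v₁ v₂ : Y} (hu : 0 ≤ ⟪u₁ - u₂, x₁ - x₂⟫)
    (hg : 0 ≤ ⟪g₁ - g₂, x₁ - x₂⟫) (hv : 0 ≤ ⟪v₁ - v₂, l₁ - l₂⟫) :
    0 ≤ ⟪x₁ - x₂, γ • (u₁ + g₁ + ContinuousLinearMap.adjoint A l₁)
        - γ • (u₂ + g₂ + ContinuousLinearMap.adjoint A l₂)⟫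
      + ⟪l₁ - l₂, γ • (v₁ + b - A x₁) - γ • (v₂ + b - A x₂)⟫ := by
  have h1 : γ • (u₁ + g₁ + ContinuousLinearMap.adjoint A l₁)
        - γ • (u₂ + g₂ + ContinuousLinearMap.adjoint A l₂)
      = γ • ((u₁ - u₂) + (g₁ - g₂) + ContinuousLinearMap.adjoint A (l₁ - l₂)) := by
    rw [map_sub]; module
  have h2 : γ • (v₁ + b - A x₁) - γ • (v₂ + b - A x₂) = γ • ((v₁ - v₂) - A (x₁ - x₂)) := by
    rw [map_sub]; module
  rw [h1, h2, real_inner_smul_right, real_inner_smul_right, ← mul_add]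
  refine mul_nonneg hγ ?_
  rw [inner_add_right, inner_add_right, inner_sub_right (l₁ - l₂) (v₁ - v₂),
    ContinuousLinearMap.adjoint_inner_right]
  linarith [real_inner_comm (u₁ - u₂) (x₁ - x₂), real_inner_comm (g₁ - g₂) (x₁ - x₂),
    real_inner_comm (v₁ - v₂) (l₁ - l₂), real_inner_comm (A (x₁ - x₂)) (l₁ - l₂)]

end Saddle

lemma momentum_recursion {E : Type*} [AddCommGroup E] [Module ℝ E] {α c : ℝ} (hα : 0 < α)
    {x y : ℕ → E}
    (hy : ∀ k : ℕ, 1 ≤ k → y k = x k + (1 - α / ((k : ℝ) + α)) • (x k - x (k - 1))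
        + (1 - c / ((k : ℝ) + α)) • (y (k - 1) - x k)) (k : ℕ) :
    ((k : ℝ) + 1) • (x (k + 1) - x k) + ((k : ℝ) + 1 + α - c) • (y k - x (k + 1))
      = ((k : ℝ) + 1 + α) • (x (k + 2) - x (k + 1) + (y (k + 1) - x (k + 2))) := by
  have h := hy (k + 1) (by omega)
  simp only [Nat.add_sub_cancel] at h
  push_cast at h
  have hk : (k : ℝ) + 1 + α ≠ 0 := by positivity
  rw [h]
  rw [show x (k + 2) - x (k + 1) + (x (k + 1) + (1 - α / ((k : ℝ) + 1 + α)) • (x (k + 1) - x k)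
    + (1 - c / ((k : ℝ) + 1 + α)) • (y k - x (k + 1)) - x (k + 2)) =
    (1 - α / ((k : ℝ) + 1 + α)) • (x (k + 1) - x k)
    + (1 - c / ((k : ℝ) + 1 + α)) • (y k - x (k + 1)) by abel, smul_add, smul_smul, smul_smul]
  congr 2
  · field_simp
    ring
  · field_simp

theorem stmt_13
    {X : Type*} [NormedAddCommGroup X] [InnerProductSpace ℝ X] [CompleteSpace X]
    {Y : Type*} [NormedAddCommGroup Y] [InnerProductSpace ℝ Y] [CompleteSpace Y]
    (K : Set Y) (hKne : K.Nonempty) (hKcl : IsClosed K) (hKcvx : Convex ℝ K)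
    (hKcone : ∀ t : ℝ, 0 ≤ t → ∀ ζ ∈ K, t • ζ ∈ K)
    (f : X → ℝ) (hf : ConvexOn ℝ Set.univ f) (hflsc : LowerSemicontinuous f)
    (h : X → ℝ) (h' : X → X)
    (hh : ConvexOn ℝ Set.univ h) (hh' : ∀ a : X, HasGradientAt h (h' a) a)
    (Lh : ℝ) (hLh : 0 ≤ Lh) (hh'lip : ∀ a b : X, ‖h' a - h' b‖ ≤ Lh * ‖a - b‖)
    (A : X →L[ℝ] Y) (b : Y) (α c γ : ℝ)
    (hα : 2 < α) (hcl : α / 2 < c) (hcu : c < α - 1)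
    (hγ0 : 0 < γ) (hγ : γ < 1 / (2 * Real.sqrt ((Lh + ‖A‖) ^ 2 + ‖A‖ ^ 2)))
    (x y1 w1 : ℕ → X) (lam y2 w2 : ℕ → Y) (u : ℕ → X) (v : ℕ → Y)
    (hy1 : ∀ k : ℕ, 1 ≤ k → y1 k = x k + (1 - α / ((k : ℝ) + α)) • (x k - x (k - 1))
        + (1 - c / ((k : ℝ) + α)) • (y1 (k - 1) - x k))
    (hy2 : ∀ k : ℕ, 1 ≤ k → y2 k = lam k + (1 - α / ((k : ℝ) + α)) • (lam k - lam (k - 1))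
        + (1 - c / ((k : ℝ) + α)) • (y2 (k - 1) - lam k))
    (hw1 : ∀ k : ℕ, 1 ≤ k → w1 k = y1 k - (y1 (k - 1) - x k))
    (hw2 : ∀ k : ℕ, 1 ≤ k → w2 k = y2 k - (y2 (k - 1) - lam k))
    (hu : ∀ k : ℕ, u (k + 1) = γ⁻¹ • (y1 k - x (k + 1)) - h' (w1 k)
        - (ContinuousLinearMap.adjoint A) (w2 k))
    (husub : ∀ k : ℕ, ∀ x' : X, f (x (k + 1)) + ⟪u (k + 1), x' - x (k + 1)⟫ ≤ f x')
    (hlamK : ∀ k : ℕ, ∀ ζ ∈ K, 0 ≤ ⟪lam (k + 1), ζ⟫)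
    (hvdef : ∀ k : ℕ, v (k + 1) = γ⁻¹ • (y2 k - lam (k + 1)) + A (w1 k) - b)
    (hvnc : ∀ k : ℕ, ∀ μ : Y, (∀ ζ ∈ K, 0 ≤ ⟪μ, ζ⟫) → ⟪v (k + 1), μ - lam (k + 1)⟫ ≤ 0)
    (hsol : ∃ (xs : X) (ls : Y),
      (∀ ζ ∈ K, 0 ≤ ⟪ls, ζ⟫) ∧ A xs - b ∈ -K ∧ ⟪ls, A xs - b⟫ = 0 ∧
      (∀ x' : X, f xs + ⟪-h' xs - (ContinuousLinearMap.adjoint A) ls, x' - xs⟫ ≤ f x')) :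
    ∃ (xb : X) (lb : Y),
      ((∀ ζ ∈ K, 0 ≤ ⟪lb, ζ⟫) ∧ A xb - b ∈ -K ∧ ⟪lb, A xb - b⟫ = 0 ∧
        (∀ x' : X, f xb + ⟪-h' xb - (ContinuousLinearMap.adjoint A) lb, x' - xb⟫ ≤ f x')) ∧
      (∀ p : X, Tendsto (fun k : ℕ => ⟪x k, p⟫) atTop (nhds ⟪xb, p⟫)) ∧
      (∀ q : Y, Tendsto (fun k : ℕ => ⟪lam k, q⟫) atTop (nhds ⟪lb, q⟫)) := by
  obtain ⟨θ, hθdef⟩ : ∃ θ, θ = γ * √((Lh + ‖A‖) ^ 2 + ‖A‖ ^ 2) := ⟨_, rfl⟩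
  have hθ0 : 0 ≤ θ := by rw [hθdef]; positivity
  have hθ : θ < 1 / 2 := by
    have hs0 : 0 < √((Lh + ‖A‖) ^ 2 + ‖A‖ ^ 2) := by
      refine lt_of_le_of_ne (Real.sqrt_nonneg _) fun hs => ?_
      rw [← hs, mul_zero, div_zero] at hγ
      linarith
    rw [lt_div_iff₀ (by positivity)] at hγ
    linarith
  have hθsq : θ ^ 2 = γ ^ 2 * ((Lh + ‖A‖) ^ 2 + ‖A‖ ^ 2) := by
    rw [hθdef, mul_pow, Real.sq_sqrt (by positivity)]
  have hc : 1 < c := by linarith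
  have hgradmono : ∀ p q : X, 0 ≤ ⟪h' p - h' q, p - q⟫ := by
    intro p q
    have h1 := hh.add_inner_le_of_hasGradientAt (hh' p) q
    have h2 := hh.add_inner_le_of_hasGradientAt (hh' q) p
    rw [← neg_sub p q, inner_neg_right] at h1
    rw [inner_sub_left]
    linarith
  have hsubmono : ∀ {p q up uq : X}, (∀ x' : X, f p + ⟪up, x' - p⟫ ≤ f x') →
      (∀ x' : X, f q + ⟪uq, x' - q⟫ ≤ f x') → 0 ≤ ⟪up - uq, p - q⟫ := by
    intro p q up uq hp hq
    have h1 := hp q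
    have h2 := hq p
    rw [← neg_sub p q, inner_neg_right] at h1
    rw [inner_sub_left]
    linarith
  have hncmono : ∀ {p q vp vq : Y}, ⟪vp, q - p⟫ ≤ 0 → ⟪vq, p - q⟫ ≤ 0 →
      0 ≤ ⟪vp - vq, p - q⟫ := by
    intro p q vp vq hp hq
    rw [← neg_sub p q, inner_neg_right] at hp
    rw [inner_sub_left]
    linarith
  obtain ⟨z, hz⟩ : ∃ z : ℕ → WithLp 2 (X × Y), z = fun k => WithLp.toLp 2 (x k, lam k) :=
    ⟨_, rfl⟩
  obtain ⟨V, hV⟩ : ∃ V : ℕ → WithLp 2 (X × Y), V = fun k =>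
    WithLp.toLp 2 (y1 (k - 1) - x k, y2 (k - 1) - lam k) := ⟨_, rfl⟩
  obtain ⟨W, hW⟩ : ∃ W : ℕ → WithLp 2 (X × Y), W = fun k =>
    WithLp.toLp 2 (γ • (u k + h' (x k) + ContinuousLinearMap.adjoint A (lam k)),
      γ • (v k + b - A (x k))) := ⟨_, rfl⟩
  have hrec : ∀ k : ℕ, ((k : ℝ) + 1) • (z (k + 1) - z k) + ((k : ℝ) + 1 + α - c) • V (k + 1)
      = ((k : ℝ) + 1 + α) • (z (k + 2) - z (k + 1) + V (k + 2)) := by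
    intro k
    rw [hz, hV]
    exact congrArg (WithLp.toLp 2) (Prod.ext (momentum_recursion (by linarith) hy1 k)
      (momentum_recursion (by linarith) hy2 k))
  have herr : ∀ k : ℕ, ‖V (k + 2) - W (k + 2)‖ ≤ θ * ‖V (k + 2) - V (k + 1)‖ := by
    intro k
    have hd : w1 (k + 1) - x (k + 2) = (y1 (k + 1) - x (k + 2)) - (y1 k - x (k + 1)) := by
      rw [hw1 (k + 1) (by omega), Nat.add_sub_cancel]; abel
    have he : w2 (k + 1) - lam (k + 2) = (y2 (k + 1) - lam (k + 2)) - (y2 k - lam (k + 1)) := by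
      rw [hw2 (k + 1) (by omega), Nat.add_sub_cancel]; abel
    have h1 : y1 (k + 1) - x (k + 2) - γ • (u (k + 2) + h' (x (k + 2))
        + ContinuousLinearMap.adjoint A (lam (k + 2)))
        = γ • (h' (w1 (k + 1)) - h' (x (k + 2))
          + ContinuousLinearMap.adjoint A (w2 (k + 1) - lam (k + 2))) := by
      rw [hu (k + 1), map_sub]
      simp only [smul_add, smul_sub, smul_inv_smul₀ hγ0.ne']
      abel
    have h2 : y2 (k + 1) - lam (k + 2) - γ • (v (k + 2) + b - A (x (k + 2)))
        = -(γ • A (w1 (k + 1) - x (k + 2))) := by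
      rw [hvdef (k + 1), map_sub]
      simp only [smul_add, smul_sub, smul_inv_smul₀ hγ0.ne']
      abel
    have h3 : ‖V (k + 2) - W (k + 2)‖ ^ 2 = γ ^ 2 * (‖h' (w1 (k + 1)) - h' (x (k + 2))
        + ContinuousLinearMap.adjoint A (w2 (k + 1) - lam (k + 2))‖ ^ 2
        + ‖A (w1 (k + 1) - x (k + 2))‖ ^ 2) := by
      rw [hV, hW, WithLp.prod_norm_sq_eq_of_L2]
      change ‖y1 (k + 1) - x (k + 2) - γ • (u (k + 2) + h' (x (k + 2))
        + ContinuousLinearMap.adjoint A (lam (k + 2)))‖ ^ 2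
        + ‖y2 (k + 1) - lam (k + 2) - γ • (v (k + 2) + b - A (x (k + 2)))‖ ^ 2 = _
      rw [h1, h2, norm_neg, norm_smul, norm_smul, mul_pow, mul_pow, Real.norm_eq_abs, sq_abs]
      ring
    have h4 : ‖V (k + 2) - V (k + 1)‖ ^ 2 = ‖w1 (k + 1) - x (k + 2)‖ ^ 2
        + ‖w2 (k + 1) - lam (k + 2)‖ ^ 2 := by
      rw [hd, he, hV, WithLp.prod_norm_sq_eq_of_L2]
      rfl
    refine le_of_sq_le_sq ?_ (by positivity)
    rw [mul_pow, h3, h4, hθsq, mul_assoc]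
    exact mul_le_mul_of_nonneg_left
      (lipschitz_operator_bound hLh A (hh'lip _ _)) (sq_nonneg γ)
  have hmono : ∀ k : ℕ, 0 ≤ ⟪z (k + 3) - z (k + 2), W (k + 3) - W (k + 2)⟫ := by
    intro k
    rw [hz, hW, WithLp.prod_inner_apply]
    exact primal_dual_operator_monotone hγ0.le A b
      (hsubmono (husub (k + 2)) (husub (k + 1))) (hgradmono _ _)
      (hncmono (hvnc (k + 2) _ (hlamK (k + 1))) (hvnc (k + 1) _ (hlamK (k + 2))))
  obtain ⟨S, hS⟩ : ∃ S : Set (WithLp 2 (X × Y)), S = {p |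
      (∀ ζ ∈ K, 0 ≤ ⟪p.snd, ζ⟫) ∧ A p.fst - b ∈ -K ∧ ⟪p.snd, A p.fst - b⟫ = 0 ∧
      (∀ x' : X, f p.fst + ⟪-h' p.fst - (ContinuousLinearMap.adjoint A) p.snd, x' - p.fst⟫
        ≤ f x')} := ⟨_, rfl⟩
  have hconv : ∀ p ∈ S, (∃ l, Tendsto (fun k => ‖z k - p‖) atTop (nhds l)) ∧
      Tendsto V atTop (nhds 0) := by
    intro p hp
    rw [hS] at hp
    obtain ⟨hp1, hp2, hp3, hp4⟩ := hp
    refine norm_sub_tendsto_of_fast_scheme hc hcu hθ0 hθ hrec herr hmono fun k => ?_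
    have h1 := primal_dual_operator_monotone hγ0.le A b
      (hsubmono (husub (k + 1)) hp4) (hgradmono (x (k + 2)) p.fst)
      (hncmono (vq := A p.fst - b) (hvnc (k + 1) _ hp1) (by
        have h2 := hlamK (k + 1) _ (Set.mem_neg.1 hp2)
        rw [inner_neg_right] at h2
        rw [inner_sub_right, real_inner_comm (lam (k + 2)), real_inner_comm p.snd, hp3]
        linarith))
    rw [show -h' p.fst - ContinuousLinearMap.adjoint A p.snd + h' p.fst
      + ContinuousLinearMap.adjoint A p.snd = 0 by abel,
      show A p.fst - b + b - A p.fst = 0 by abel, smul_zero, smul_zero, sub_zero, sub_zero] at h1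
    rw [hz, hW, WithLp.prod_inner_apply]
    exact h1
  have hSne : S.Nonempty := by
    obtain ⟨xs, ls, hs⟩ := hsol
    exact ⟨WithLp.toLp 2 (xs, ls), by rw [hS]; exact hs⟩
  obtain ⟨p₀, hp₀⟩ := hSne
  have hV0 := (hconv p₀ hp₀).2
  have hW0 : Tendsto W atTop (nhds 0) := by
    rw [← tendsto_add_atTop_iff_nat 2]
    have h1 := (tendsto_add_atTop_iff_nat 2).2 hV0
    have h2 := (tendsto_add_atTop_iff_nat 1).2 hV0
    have h3 : Tendsto (fun k => V (k + 2) - W (k + 2)) atTop (nhds 0) := by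
      have h4 := (h1.sub h2).norm.const_mul θ
      rw [sub_zero, norm_zero, mul_zero] at h4
      exact squeeze_zero_norm herr h4
    simpa using h1.sub h3
  obtain ⟨B, hB⟩ : ∃ B, ∀ k, ‖z k‖ ≤ B := by
    obtain ⟨l, hl⟩ := (hconv p₀ hp₀).1
    obtain ⟨B, hB⟩ := hl.bddAbove_range
    refine ⟨B + ‖p₀‖, fun k => ?_⟩
    have h1 := hB ⟨k, rfl⟩
    have h2 := norm_sub_norm_le (z k) p₀
    simp only at h1
    linarith
  have hG : ConvexOn ℝ Set.univ (f + h) := hf.add hh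
  have hGlsc : LowerSemicontinuous (f + h) :=
    hflsc.add (continuous_iff_continuousAt.2 fun a => (hh' a).continuousAt).lowerSemicontinuous
  have hfstlim : ∀ (U : Filter ℕ) (zb : WithLp 2 (X × Y)),
      (∀ p, Tendsto (fun k => ⟪z k, p⟫) U (nhds ⟪zb, p⟫)) →
      ∀ p : X, Tendsto (fun k => ⟪x k, p⟫) U (nhds ⟪zb.fst, p⟫) := by
    intro U zb hzb p
    have := hzb (WithLp.toLp 2 (p, 0))
    simpa [WithLp.prod_inner_apply, hz] using this
  have hsndlim : ∀ (U : Filter ℕ) (zb : WithLp 2 (X × Y)),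
      (∀ p, Tendsto (fun k => ⟪z k, p⟫) U (nhds ⟪zb, p⟫)) →
      ∀ q : Y, Tendsto (fun k => ⟪lam k, q⟫) U (nhds ⟪zb.snd, q⟫) := by
    intro U zb hzb q
    have := hzb (WithLp.toLp 2 (0, q))
    simpa [WithLp.prod_inner_apply, hz] using this
  obtain ⟨zb, hzbS, hzb⟩ := exists_weak_limit_of_opial (z := z) ⟨p₀, hp₀⟩
    (fun p hp => (hconv p hp).1) (by
      intro U hU zb hzb
      have hxl := hfstlim U zb hzb
      have hll := hsndlim U zb hzb
      rw [hS]
      refine primal_dual_of_saddle hKne hKcl hKcvx hKcone hf A b (hh' _) ?_ ?_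
      · intro ζ hζ
        refine ge_of_tendsto (hll ζ) (hU ?_)
        filter_upwards [eventually_ge_atTop 1] with k hk
        obtain ⟨j, rfl⟩ : ∃ j, k = j + 1 := ⟨k - 1, by omega⟩
        exact hlamK j ζ hζ
      · intro x' μ hμ
        have hWγ := (hW0.const_smul γ⁻¹).mono_left hU
        rw [smul_zero] at hWγ
        have hW1 := ((WithLp.continuous_fst 2 X Y).tendsto _).comp hWγ
        have hW2 := ((WithLp.continuous_snd 2 X Y).tendsto _).comp hWγ
        refine saddle_of_weak_limit hG hGlsc A b hxl hll hW1 hW2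
          (fun k => by have h := (WithLp.norm_fst_le _ (z k)).trans (hB k); rw [hz] at h; exact h)
          (fun k => by have h := (WithLp.norm_snd_le _ (z k)).trans (hB k); rw [hz] at h; exact h) (hU ?_)
        filter_upwards [eventually_ge_atTop 1] with k hk
        obtain ⟨j, rfl⟩ : ∃ j, k = j + 1 := ⟨k - 1, by omega⟩
        have e1 : ((fun p : WithLp 2 (X × Y) => p.fst) ∘ fun k => γ⁻¹ • W k) (j + 1) =
            u (j + 1) + h' (x (j + 1)) + ContinuousLinearMap.adjoint A (lam (j + 1)) := by
          rw [hW]; exact inv_smul_smul₀ hγ0.ne' _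
        have e2 : ((fun p : WithLp 2 (X × Y) => p.snd) ∘ fun k => γ⁻¹ • W k) (j + 1) =
            v (j + 1) + b - A (x (j + 1)) := by
          rw [hW]; exact inv_smul_smul₀ hγ0.ne' _
        rw [e1, e2]
        have h1 := husub j x'
        have h2 := hh.add_inner_le_of_hasGradientAt (hh' (x (j + 1))) x'
        have h3 := hvnc j μ hμ
        simp only [Pi.add_apply, inner_add_left, inner_sub_left (v (j + 1) + b),
          ContinuousLinearMap.adjoint_inner_left, map_sub]
        have h4 : ⟪lam (j + 1), A x' - A (x (j + 1))⟫ =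
            ⟪lam (j + 1), A x'⟫ - ⟪A (x (j + 1)), lam (j + 1)⟫ := by
          rw [inner_sub_right, real_inner_comm (lam (j + 1)) (A (x (j + 1)))]
        have h5 : ⟪A (x (j + 1)), μ - lam (j + 1)⟫ =
            ⟪A (x (j + 1)), μ⟫ - ⟪A (x (j + 1)), lam (j + 1)⟫ := inner_sub_right _ _ _
        rw [h4, h5]
        linarith)
  rw [hS] at hzbS
  exact ⟨zb.fst, zb.snd, hzbS, hfstlim _ _ hzb, hsndlim _ _ hzb⟩
end
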